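/- Let (p^(1), p^(2)) and (q^(1), q^(2)) be dichotomies with supp p^(1) ⊊ supp p^(2). Then the following are equivalent: (i) D_α(p^(1)‖p^(2)) ≥ D_α(q^(1)‖q^(2)) for every α ∈ (0,∞) and for α = ∞; (ii) for every ε > 0 there exist a stochastic matrix T_ε and dichotomies (q_ε^(1), q_ε^(2)) and (r_ε^(1), r_ε^(2)) with ‖q^(k) − q_ε^(k)‖₁ ≤ ε and T_ε(r_ε^(k) ⊗ p^(k)) = r_ε^(k) ⊗ q_ε^(k) for k = 1, 2 (and one may take r_ε^(k) = (1/(n+1)) ⊕_{ℓ=0}^{n} (q_ε^(k))^{⊗ℓ} ⊗ (p^(k))^{⊗(n−ℓ)} for n sufficiently large); (iii) for every ε > 0 there is a dichotomy (q_ε^(1), q_ε^(2)) with ‖q^(k) − q_ε^(k)‖₁ ≤ ε for k = 1, 2, such that for all sufficiently large n there is a stochastic matrix T_{ε,n} with T_{ε,n}(p^(k))^{⊗n} = (q_ε^(k))^{⊗n} for k = 1, 2. Moreover, in (ii) and (iii) one may additionally take q_ε^(2) = q^(2) for all ε > 0. -/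

import Mathlib

open Classical

noncomputable section

/-- `p` is a probability vector. -/
def IsProb {I : Type} [Fintype I] (p : I → ℝ) : Prop :=
  (∀ x, 0 ≤ p x) ∧ ∑ x, p x = 1

/-- `T` is a (column-)stochastic matrix (`T y x` is the entry in row `y`, column `x`). -/
def IsStoch {I J : Type} [Fintype I] [Fintype J] (T : J → I → ℝ) : Prop :=
  (∀ y x, 0 ≤ T y x) ∧ ∀ x, ∑ y, T y x = 1

/-- Kronecker product of two vectors. -/
def kron {I J : Type} (p : I → ℝ) (q : J → ℝ) : I × J → ℝ := fun x => p x.1 * q x.2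

/-- `n`-fold Kronecker power `p^{⊗n}`. -/
def kpow {I : Type} (p : I → ℝ) (n : ℕ) : (Fin n → I) → ℝ := fun f => ∏ j, p (f j)

/-- Index type of the catalyst `⊕_{ℓ=0}^{n} (q)^{⊗ℓ} ⊗ (p)^{⊗(n-ℓ)}`
(`I` indexes `p`, `J` indexes `q`). -/
abbrev CatIdx (I J : Type) (n : ℕ) : Type :=
  (ℓ : Fin (n + 1)) × ((Fin (ℓ : ℕ) → J) × (Fin (n - (ℓ : ℕ)) → I))

/-- The catalyst `r = (1/(n+1)) ⊕_{ℓ=0}^{n} q^{⊗ℓ} ⊗ p^{⊗(n-ℓ)}`. -/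
def catVec {I J : Type} (n : ℕ) (p : I → ℝ) (q : J → ℝ) : CatIdx I J n → ℝ :=
  fun x => (1 / (n + 1 : ℝ)) * ((∏ j, q (x.2.1 j)) * ∏ j, p (x.2.2 j))

/-- The multivariate monotone `Φ_{α,C}` (convention `0^0 = 1` of `rpow`). -/
def phiAC {I : Type} [Fintype I] (d : ℕ) (α : Fin d → ℝ) (C : Finset (Fin d))
    (p : Fin d → I → ℝ) : ℝ :=
  ∑ x ∈ Finset.univ.filter (fun x => ∀ c ∈ C, p c x ≠ 0), ∏ k, p k x ^ α k

/-- The standard basis vector `e_k` of `ℝ^d`. -/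
def stdBasis (d : ℕ) (k : Fin d) : Fin d → ℝ := fun j => if j = k then 1 else 0

/-- ℓ¹-distance of vectors. -/
def dist1 {I : Type} [Fintype I] (p q : I → ℝ) : ℝ := ∑ x, |p x - q x|

/-- A dichotomy: a pair of probability vectors with `supp p ⊆ supp q`. -/
def IsDichotomy {I : Type} [Fintype I] (p q : I → ℝ) : Prop :=
  IsProb p ∧ IsProb q ∧ ∀ x, p x ≠ 0 → q x ≠ 0

/-- The Rényi divergence `D_α(p‖q)` for `α ∈ [0,∞)`, with values in `EReal`
(`⊤` encodes `+∞`; all divergences are `⊤` if `supp p ∩ supp q = ∅`). -/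
def renyi {I : Type} [Fintype I] (α : ℝ) (p q : I → ℝ) : EReal :=
  if ¬ ∃ x, p x ≠ 0 ∧ q x ≠ 0 then ⊤
  else if α = 0 then
    ((-Real.log (∑ x ∈ Finset.univ.filter (fun x => p x ≠ 0 ∧ q x ≠ 0), q x) : ℝ) : EReal)
  else if α < 1 then
    (((α - 1)⁻¹ * Real.log (∑ x ∈ Finset.univ.filter (fun x => p x ≠ 0 ∧ q x ≠ 0),
        p x ^ α * q x ^ (1 - α)) : ℝ) : EReal)
  else if α = 1 then
    if ∀ x, p x ≠ 0 → q x ≠ 0 then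
      ((∑ x ∈ Finset.univ.filter (fun x => p x ≠ 0), p x * Real.log (p x / q x) : ℝ) : EReal)
    else ⊤
  else
    if ∀ x, p x ≠ 0 → q x ≠ 0 then
      (((α - 1)⁻¹ * Real.log (∑ x ∈ Finset.univ.filter (fun x => p x ≠ 0),
          p x ^ α * q x ^ (1 - α)) : ℝ) : EReal)
    else ⊤

/-- The max divergence `D_∞(p‖q)`, with values in `EReal`. -/
def renyiTop {I : Type} [Fintype I] (p q : I → ℝ) : EReal :=
  if h : ∃ x, p x ≠ 0 ∧ q x ≠ 0 then
    if ∀ x, p x ≠ 0 → q x ≠ 0 then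
      ((Real.log ((Finset.univ.filter fun x => p x ≠ 0).sup'
        ⟨h.choose, Finset.mem_filter.mpr ⟨Finset.mem_univ _, h.choose_spec.1⟩⟩
        fun x => p x / q x) : ℝ) : EReal)
    else ⊤
  else ⊤

/-- Approximate catalytic majorization of the dichotomy `(q₁,q₂)` by `(p₁,p₂)` with
vanishing error, where the approximants' second member must satisfy `extra`; includes
the claim that the explicit binomial catalyst works for all large `n`. -/
def CondCat {I J : Type} [Fintype I] [Fintype J]
    (p₁ p₂ : I → ℝ) (q₁ q₂ : J → ℝ) (extra : (J → ℝ) → Prop) : Prop :=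
  ∀ ε : ℝ, 0 < ε → ∃ qe₁ qe₂ : J → ℝ, IsDichotomy qe₁ qe₂ ∧
    dist1 q₁ qe₁ ≤ ε ∧ dist1 q₂ qe₂ ≤ ε ∧ extra qe₂ ∧
    (∃ (R : Type) (_ : Fintype R) (r₁ r₂ : R → ℝ), IsDichotomy r₁ r₂ ∧
      ∃ T : R × J → R × I → ℝ, IsStoch T ∧
        (∀ y, ∑ x, T y x * kron r₁ p₁ x = kron r₁ qe₁ y) ∧
        (∀ y, ∑ x, T y x * kron r₂ p₂ x = kron r₂ qe₂ y)) ∧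
    (∃ N : ℕ, ∀ n ≥ N,
      ∃ T : CatIdx I J n × J → CatIdx I J n × I → ℝ, IsStoch T ∧
        (∀ y, ∑ x, T y x * kron (catVec n p₁ qe₁) p₁ x = kron (catVec n p₁ qe₁) qe₁ y) ∧
        (∀ y, ∑ x, T y x * kron (catVec n p₂ qe₂) p₂ x = kron (catVec n p₂ qe₂) qe₂ y))

/-- Approximate large-sample majorization of the dichotomy `(q₁,q₂)` by `(p₁,p₂)` with
vanishing error, where the approximants' second member must satisfy `extra`. -/
def CondLS {I J : Type} [Fintype I] [Fintype J]
    (p₁ p₂ : I → ℝ) (q₁ q₂ : J → ℝ) (extra : (J → ℝ) → Prop) : Prop :=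
  ∀ ε : ℝ, 0 < ε → ∃ qe₁ qe₂ : J → ℝ, IsDichotomy qe₁ qe₂ ∧
    dist1 q₁ qe₁ ≤ ε ∧ dist1 q₂ qe₂ ≤ ε ∧ extra qe₂ ∧
    ∃ N : ℕ, ∀ n ≥ N,
      ∃ T : (Fin n → J) → (Fin n → I) → ℝ, IsStoch T ∧
        (∀ g, ∑ f, T g f * kpow p₁ n f = kpow qe₁ n g) ∧
        (∀ g, ∑ f, T g f * kpow p₂ n f = kpow qe₂ n g)

/-- The sum of a statistic along a sample path. -/
def pathSum {I : Type} {n : ℕ} (l : I → ℝ) (f : Fin n → I) : ℝ := ∑ j, l (f j)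

/-- The exponential moment `∑ b e^{αl}` of a weighted statistic. -/
def tiltSum {I : Type} [Fintype I] (b l : I → ℝ) (α : ℝ) : ℝ := ∑ x, b x * Real.exp (α * l x)

/-- The mean of `l` under the exponentially tilted weights. -/
def tiltMean {I : Type} [Fintype I] (b l : I → ℝ) (α : ℝ) : ℝ :=
  (∑ x, b x * Real.exp (α * l x) * l x) / tiltSum b l α

/-- The hockey-stick functional of the `n`-fold power of `(b e^l, b)`. -/
def pathExcess {I : Type} [Fintype I] (b l : I → ℝ) (n : ℕ) (t : ℝ) : ℝ :=
  ∑ f : Fin n → I, kpow b n f * max (Real.exp (pathSum l f) - t) 0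

/-- The complementary functional to `pathExcess`. -/
def pathOverlap {I : Type} [Fintype I] (b l : I → ℝ) (n : ℕ) (t : ℝ) : ℝ :=
  ∑ f : Fin n → I, kpow b n f * min (Real.exp (pathSum l f)) t

lemma kpow_nonneg {I : Type} {w : I → ℝ} (hw : ∀ x, 0 ≤ w x) (n : ℕ) (f : Fin n → I) : 0 ≤ kpow w n f :=
  Finset.prod_nonneg fun _ _ => hw _

lemma kpow_tilt {I : Type} (b l : I → ℝ) (α : ℝ) (n : ℕ) (f : Fin n → I) :
    kpow (fun x => b x * Real.exp (α * l x)) n f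
      = kpow b n f * Real.exp (α * pathSum l f) := by
  simp only [kpow, pathSum, Finset.prod_mul_distrib, Finset.mul_sum, Real.exp_sum]

section LargeDeviations

variable {I : Type} [Fintype I]

lemma sum_kpow (w : I → ℝ) (n : ℕ) : ∑ f, kpow w n f = (∑ x, w x) ^ n := by
  simp only [kpow]
  exact (Fintype.sum_pow w n).symm

lemma sum_kpow_tilt (b l : I → ℝ) (α : ℝ) (n : ℕ) :
    ∑ f, kpow b n f * Real.exp (α * pathSum l f) = tiltSum b l α ^ n := by
  simp only [← kpow_tilt, sum_kpow, tiltSum]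

lemma sum_fin_succ_fun (n : ℕ) (F : (Fin (n + 1) → I) → ℝ) :
    ∑ f, F f = ∑ x, ∑ f : Fin n → I, F (Fin.cons x f) := by
  rw [← Fintype.sum_prod_type', ← (Fin.consEquiv fun _ => I).sum_comp]
  rfl

lemma pathSum_moments {w : I → ℝ} (hw : ∑ x, w x = 1) {g : I → ℝ} (hg : ∑ x, w x * g x = 0)
    (n : ℕ) : ∑ f : Fin n → I, kpow w n f * pathSum g f = 0 ∧
      ∑ f : Fin n → I, kpow w n f * pathSum g f ^ 2 = n * ∑ x, w x * g x ^ 2 := by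
  induction n with
  | zero => simp [pathSum]
  | succ n ih =>
    have h1 : ∑ f, kpow w n f = 1 := by rw [sum_kpow, hw, one_pow]
    have hk : ∀ x (f : Fin n → I), kpow w (n + 1) (Fin.cons x f) = w x * kpow w n f := by
      intro x f; simp [kpow, Fin.prod_univ_succ]
    have hp : ∀ x (f : Fin n → I), pathSum g (Fin.cons x f : Fin (n + 1) → I)
        = g x + pathSum g f := by
      intro x f; simp [pathSum, Fin.sum_univ_succ]
    constructor
    · rw [sum_fin_succ_fun]
      have : ∀ x, ∑ f : Fin n → I, kpow w (n + 1) (Fin.cons x f)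
          * pathSum g (Fin.cons x f : Fin (n + 1) → I) = w x * g x := by
        intro x
        calc _ = ∑ f : Fin n → I, (w x * g x * kpow w n f
              + w x * (kpow w n f * pathSum g f)) := by
              refine Finset.sum_congr rfl fun f _ => ?_
              rw [hk, hp]; ring
          _ = _ := by
              rw [Finset.sum_add_distrib, ← Finset.mul_sum, ← Finset.mul_sum, h1, ih.1]; ring
      rw [Finset.sum_congr rfl fun x _ => this x, hg]
    · rw [sum_fin_succ_fun]
      have : ∀ x, ∑ f : Fin n → I, kpow w (n + 1) (Fin.cons x f)
          * pathSum g (Fin.cons x f : Fin (n + 1) → I) ^ 2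
          = w x * g x ^ 2 + w x * (n * ∑ x, w x * g x ^ 2) := by
        intro x
        calc _ = ∑ f : Fin n → I, (w x * g x ^ 2 * kpow w n f
              + 2 * w x * g x * (kpow w n f * pathSum g f)
              + w x * (kpow w n f * pathSum g f ^ 2)) := by
              refine Finset.sum_congr rfl fun f _ => ?_
              rw [hk, hp]; ring
          _ = _ := by
              rw [Finset.sum_add_distrib, Finset.sum_add_distrib, ← Finset.mul_sum,
                ← Finset.mul_sum, ← Finset.mul_sum, h1, ih.1, ih.2]; ring
      rw [Finset.sum_congr rfl fun x _ => this x, Finset.sum_add_distrib, ← Finset.sum_mul, hw]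
      push_cast; ring

/-- Chebyshev's inequality for sample paths. -/
lemma chebyshev_kpow {w : I → ℝ} (hw : IsProb w) (l : I → ℝ) {B : ℝ} (hB : ∀ x, |l x| ≤ B)
    {δ : ℝ} (hδ : 0 < δ) {n : ℕ} (hn : 16 * B ^ 2 ≤ n * δ ^ 2) (hn0 : 0 < n) :
    3 / 4 ≤ ∑ f ∈ Finset.univ.filter
      (fun f : Fin n → I => |pathSum l f - n * ∑ x, w x * l x| ≤ n * δ), kpow w n f := by
  set μ := ∑ x, w x * l x with hμ
  have hn' : (0 : ℝ) < n := by exact_mod_cast hn0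
  have hB0 : 0 ≤ B ∨ IsEmpty I := by
    by_cases h : Nonempty I
    · exact Or.inl ((abs_nonneg _).trans (hB h.some))
    · exact Or.inr (not_nonempty_iff.mp h)
  rcases hB0 with hB0 | hI
  swap
  · exact absurd hw.2 (by simp)
  have hμB : |μ| ≤ B := by
    calc |μ| ≤ ∑ x, |w x * l x| := Finset.abs_sum_le_sum_abs _ _
      _ ≤ ∑ x, w x * B := by
          refine Finset.sum_le_sum fun x _ => ?_
          rw [abs_mul, abs_of_nonneg (hw.1 x)]
          exact mul_le_mul_of_nonneg_left (hB x) (hw.1 x)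
      _ = B := by rw [← Finset.sum_mul, hw.2, one_mul]
  have hg : ∑ x, w x * (l x - μ) = 0 := by
    simp only [mul_sub, Finset.sum_sub_distrib, ← Finset.sum_mul, hw.2, ← hμ]; ring
  have hps : ∀ f : Fin n → I, pathSum (fun x => l x - μ) f = pathSum l f - n * μ := by
    intro f; simp [pathSum]
  have h2 := (pathSum_moments hw.2 hg n).2
  have hv : ∑ x, w x * (l x - μ) ^ 2 ≤ 4 * B ^ 2 := by
    calc _ ≤ ∑ x, w x * (4 * B ^ 2) := by
          refine Finset.sum_le_sum fun x _ => mul_le_mul_of_nonneg_left ?_ (hw.1 x)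
          have := abs_le.mp (hB x)
          have := abs_le.mp hμB
          nlinarith
      _ = _ := by rw [← Finset.sum_mul, hw.2, one_mul]
  have htot : ∑ f, kpow w n f = 1 := by rw [sum_kpow, hw.2, one_pow]
  rw [← Finset.sum_filter_add_sum_filter_not _
    (fun f : Fin n → I => |pathSum l f - n * μ| ≤ n * δ)] at htot
  have hbad : (n * δ) ^ 2 * ∑ f ∈ Finset.univ.filter
      (fun f : Fin n → I => ¬ |pathSum l f - n * μ| ≤ n * δ), kpow w n f ≤ n * (4 * B ^ 2) := by
    calc _ ≤ ∑ f ∈ Finset.univ.filter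
          (fun f : Fin n → I => ¬ |pathSum l f - n * μ| ≤ n * δ),
            kpow w n f * pathSum (fun x => l x - μ) f ^ 2 := by
          rw [Finset.mul_sum]
          refine Finset.sum_le_sum fun f hf => ?_
          rw [mul_comm, hps]
          refine mul_le_mul_of_nonneg_left ?_ (kpow_nonneg hw.1 n f)
          have := not_le.mp (Finset.mem_filter.mp hf).2
          rw [← sq_abs (pathSum l f - n * μ)]
          exact pow_le_pow_left₀ (by positivity) this.le 2
      _ ≤ ∑ f, kpow w n f * pathSum (fun x => l x - μ) f ^ 2 :=
          Finset.sum_le_sum_of_subset_of_nonneg (Finset.filter_subset _ _)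
            fun f _ _ => mul_nonneg (kpow_nonneg hw.1 n f) (sq_nonneg _)
      _ ≤ _ := by rw [h2]; exact mul_le_mul_of_nonneg_left hv hn'.le
  set bad := ∑ f ∈ Finset.univ.filter
      (fun f : Fin n → I => ¬ |pathSum l f - n * μ| ≤ n * δ), kpow w n f
  have : bad ≤ 1 / 4 := by
    have h3 : (n * δ) ^ 2 * bad ≤ (n * δ) ^ 2 * (1 / 4) := by nlinarith
    exact le_of_mul_le_mul_left h3 (by positivity)
  linarith

lemma tiltSum_nonneg {b : I → ℝ} (hb : ∀ x, 0 ≤ b x) (l : I → ℝ) (α : ℝ) :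
    0 ≤ tiltSum b l α :=
  Finset.sum_nonneg fun x _ => mul_nonneg (hb x) (Real.exp_pos _).le

lemma tiltSum_pos {b : I → ℝ} (hb : ∀ x, 0 ≤ b x) {l : I → ℝ} (h1 : tiltSum b l 1 = 1) (α : ℝ) :
    0 < tiltSum b l α := by
  refine (tiltSum_nonneg hb l α).lt_of_ne fun h => ?_
  have h0 := (Finset.sum_eq_zero_iff_of_nonneg
    (fun x _ => mul_nonneg (hb x) (Real.exp_pos _).le)).mp h.symm
  have : tiltSum b l 1 = 0 := by
    refine Finset.sum_eq_zero fun x hx => ?_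
    rcases mul_eq_zero.mp (h0 x hx) with h | h
    · simp [h]
    · exact absurd h (Real.exp_pos _).ne'
  linarith

/-- Concentration of the path statistic under tilted weights, uniformly in the tilt. -/
lemma tilt_concentration {b : I → ℝ} (hb : ∀ x, 0 ≤ b x) {l : I → ℝ} (h1 : tiltSum b l 1 = 1)
    {δ : ℝ} (hδ : 0 < δ) : ∃ N : ℕ, ∀ n ≥ N, ∀ α : ℝ,
      3 / 4 * tiltSum b l α ^ n ≤ ∑ f ∈ Finset.univ.filter
        (fun f : Fin n → I => |pathSum l f - n * tiltMean b l α| ≤ n * δ),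
        kpow b n f * Real.exp (α * pathSum l f) := by
  set B := ∑ x, |l x|
  have hB : ∀ x, |l x| ≤ B := fun x =>
    Finset.single_le_sum (f := fun x => |l x|) (fun _ _ => abs_nonneg _) (Finset.mem_univ x)
  obtain ⟨N, hN⟩ := exists_nat_ge (16 * B ^ 2 / δ ^ 2)
  refine ⟨N + 1, fun n hn α => ?_⟩
  have hS := tiltSum_pos hb h1 α
  set S := tiltSum b l α with hSdef
  let w : I → ℝ := fun x => S⁻¹ * (b x * Real.exp (α * l x))
  have hw : IsProb w := ⟨fun x => mul_nonneg (inv_nonneg.mpr hS.le)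
    (mul_nonneg (hb x) (Real.exp_pos _).le), by
      simp only [w, ← Finset.mul_sum]; exact inv_mul_cancel₀ hS.ne'⟩
  have hmean : ∑ x, w x * l x = tiltMean b l α := by
    simp only [w, tiltMean, ← hSdef, mul_assoc, ← Finset.mul_sum]
    rw [div_eq_inv_mul]
  have hk : ∀ f : Fin n → I, kpow w n f
      = (S ^ n)⁻¹ * (kpow b n f * Real.exp (α * pathSum l f)) := by
    intro f
    rw [← kpow_tilt]
    simp [kpow, w, Finset.prod_mul_distrib]
  have hnn : 16 * B ^ 2 ≤ n * δ ^ 2 := by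
    rw [div_le_iff₀ (by positivity)] at hN
    refine hN.trans (mul_le_mul_of_nonneg_right ?_ (by positivity))
    exact_mod_cast (Nat.le_succ N).trans hn
  have := chebyshev_kpow hw l hB hδ hnn (by omega)
  rw [hmean, Finset.sum_congr rfl fun f _ => hk f, ← Finset.mul_sum, ← div_eq_inv_mul,
    le_div_iff₀ (pow_pos hS n)] at this
  exact this

lemma hasDerivAt_tiltSum (b l : I → ℝ) (α : ℝ) :
    HasDerivAt (tiltSum b l) (∑ x, b x * Real.exp (α * l x) * l x) α := by
  unfold tiltSum
  refine HasDerivAt.fun_sum fun x _ => ?_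
  have := (((hasDerivAt_id α).mul_const (l x)).exp).const_mul (b x)
  simpa [mul_assoc] using this

lemma hasDerivAt_log_tiltSum {b : I → ℝ} (hb : ∀ x, 0 ≤ b x) {l : I → ℝ}
    (h1 : tiltSum b l 1 = 1) (α : ℝ) :
    HasDerivAt (fun α => Real.log (tiltSum b l α)) (tiltMean b l α) α :=
  (hasDerivAt_tiltSum b l α).log (tiltSum_pos hb h1 α).ne'

lemma continuous_tiltMean {b : I → ℝ} (hb : ∀ x, 0 ≤ b x) {l : I → ℝ}
    (h1 : tiltSum b l 1 = 1) : Continuous (tiltMean b l) := by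
  unfold tiltMean
  refine Continuous.div (by fun_prop) ?_ fun α => (tiltSum_pos hb h1 α).ne'
  unfold tiltSum
  fun_prop

lemma pathExcess_nonneg {b : I → ℝ} (hb : ∀ x, 0 ≤ b x) (l : I → ℝ) (n : ℕ) (t : ℝ) :
    0 ≤ pathExcess b l n t :=
  Finset.sum_nonneg fun f _ => mul_nonneg (kpow_nonneg hb n f) (le_max_right _ _)

lemma pathExcess_add_pathOverlap {b l : I → ℝ} (h1 : tiltSum b l 1 = 1) (n : ℕ) (t : ℝ) :
    pathExcess b l n t + pathOverlap b l n t = 1 := by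
  have h := sum_kpow_tilt b l 1 n
  rw [h1, one_pow] at h
  rw [pathExcess, pathOverlap, ← Finset.sum_add_distrib, ← h]
  refine Finset.sum_congr rfl fun f _ => ?_
  rw [← mul_add, one_mul]
  congr 1
  rcases le_total (Real.exp (pathSum l f)) t with h | h
  · rw [max_eq_right (by linarith), min_eq_left h]; ring
  · rw [max_eq_left (by linarith), min_eq_right h]; ring

lemma pathOverlap_le {b : I → ℝ} (hb : ∀ x, 0 ≤ b x) (l : I → ℝ) (n : ℕ) (T : ℝ) {α : ℝ}
    (h0 : 0 ≤ α) (h1 : α ≤ 1) :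
    pathOverlap b l n (Real.exp T) ≤ tiltSum b l α ^ n * Real.exp ((1 - α) * T) := by
  rw [← sum_kpow_tilt, Finset.sum_mul, pathOverlap]
  refine Finset.sum_le_sum fun f _ => ?_
  rw [mul_assoc, ← Real.exp_add]
  refine mul_le_mul_of_nonneg_left ?_ (kpow_nonneg hb n f)
  rcases le_total (pathSum l f) T with h | h
  · exact (min_le_left _ _).trans (Real.exp_le_exp.mpr (by nlinarith))
  · exact (min_le_right _ _).trans (Real.exp_le_exp.mpr (by nlinarith))

lemma pathExcess_le {b : I → ℝ} (hb : ∀ x, 0 ≤ b x) (l : I → ℝ) (n : ℕ) (T : ℝ) {α : ℝ}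
    (h1 : 1 ≤ α) :
    pathExcess b l n (Real.exp T) ≤ tiltSum b l α ^ n * Real.exp ((1 - α) * T) := by
  rw [← sum_kpow_tilt, Finset.sum_mul, pathExcess]
  refine Finset.sum_le_sum fun f _ => ?_
  rw [mul_assoc, ← Real.exp_add]
  refine mul_le_mul_of_nonneg_left (max_le ?_ (Real.exp_pos _).le) (kpow_nonneg hb n f)
  rcases le_total (pathSum l f) T with h | h
  · have := Real.exp_le_exp.mpr h
    exact (by linarith : _ ≤ (0 : ℝ)).trans (Real.exp_pos _).le
  · have := Real.exp_pos T
    have h2 : Real.exp (pathSum l f) ≤ Real.exp (α * pathSum l f + (1 - α) * T) :=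
      Real.exp_le_exp.mpr (by nlinarith)
    linarith

end LargeDeviations

section LargeDeviationsComparison

variable {I J : Type} [Fintype I] [Fintype J]

lemma le_pathExcess {b : I → ℝ} (hb : ∀ x, 0 ≤ b x) (l : I → ℝ) {n : ℕ} {α η τ : ℝ}
    (hα : 1 ≤ α)
    (hc : 3 / 4 * tiltSum b l α ^ n ≤ ∑ f ∈ Finset.univ.filter
        (fun f : Fin n → I => |pathSum l f - n * tiltMean b l α| ≤ n * η),
        kpow b n f * Real.exp (α * pathSum l f))
    (hη : Real.exp (-(n * η)) ≤ 1 / 3) (hτ : τ + 2 * η ≤ tiltMean b l α) :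
    1 / 2 * tiltSum b l α ^ n * Real.exp ((1 - α) * (n * (tiltMean b l α + η)))
      ≤ pathExcess b l n (Real.exp (n * τ)) := by
  set m := tiltMean b l α
  have hn : (0 : ℝ) ≤ n := Nat.cast_nonneg n
  calc _ = 2 / 3 * Real.exp ((1 - α) * (n * (m + η))) * (3 / 4 * tiltSum b l α ^ n) := by ring
    _ ≤ 2 / 3 * Real.exp ((1 - α) * (n * (m + η))) * _ :=
        mul_le_mul_of_nonneg_left hc (by positivity)
    _ = _ := Finset.mul_sum _ _ _
    _ ≤ ∑ f ∈ Finset.univ.filter (fun f : Fin n → I => |pathSum l f - n * m| ≤ n * η),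
          kpow b n f * max (Real.exp (pathSum l f) - Real.exp (n * τ)) 0 := by
        refine Finset.sum_le_sum fun f hf => ?_
        obtain ⟨hl, hu⟩ := abs_le.mp (Finset.mem_filter.mp hf).2
        have hlow : n * τ ≤ pathSum l f - n * η := by nlinarith
        have e1 : Real.exp (n * τ) ≤ 1 / 3 * Real.exp (pathSum l f) := by
          calc Real.exp (n * τ) ≤ Real.exp (-(n * η)) * Real.exp (pathSum l f) := by
                rw [← Real.exp_add]; exact Real.exp_le_exp.mpr (by linarith)
            _ ≤ _ := mul_le_mul_of_nonneg_right hη (Real.exp_pos _).le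
        have e2 : Real.exp ((1 - α) * (n * (m + η))) * Real.exp (α * pathSum l f)
            ≤ Real.exp (pathSum l f) := by
          rw [← Real.exp_add]; exact Real.exp_le_exp.mpr (by nlinarith)
        calc _ = kpow b n f * (2 / 3 * (Real.exp ((1 - α) * (n * (m + η)))
              * Real.exp (α * pathSum l f))) := by ring
          _ ≤ _ := mul_le_mul_of_nonneg_left (le_max_of_le_left (by linarith))
              (kpow_nonneg hb n f)
    _ ≤ _ := Finset.sum_le_sum_of_subset_of_nonneg (Finset.filter_subset _ _)
        fun f _ _ => mul_nonneg (kpow_nonneg hb n f) (le_max_right _ _)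

lemma le_pathOverlap {b : I → ℝ} (hb : ∀ x, 0 ≤ b x) (l : I → ℝ) {n : ℕ} {α η τ σ : ℝ}
    (h1 : α ≤ 1)
    (hc : 3 / 4 * tiltSum b l α ^ n ≤ ∑ f ∈ Finset.univ.filter
        (fun f : Fin n → I => |pathSum l f - n * tiltMean b l α| ≤ n * η),
        kpow b n f * Real.exp (α * pathSum l f))
    (hσ : σ ≤ tiltMean b l α) (hστ : σ - η ≤ τ)
    (hτ : α = 0 ∨ 0 ≤ α ∧ tiltMean b l α + η ≤ τ) :
    1 / 2 * tiltSum b l α ^ n * Real.exp ((1 - α) * (n * (σ - η)))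
      ≤ pathOverlap b l n (Real.exp (n * τ)) := by
  set m := tiltMean b l α
  have hn : (0 : ℝ) ≤ n := Nat.cast_nonneg n
  have hS := pow_nonneg (tiltSum_nonneg hb l α) n
  calc _ ≤ Real.exp ((1 - α) * (n * (σ - η))) * (3 / 4 * tiltSum b l α ^ n) := by
        have := mul_nonneg hS (Real.exp_pos ((1 - α) * (n * (σ - η)))).le
        nlinarith
    _ ≤ Real.exp ((1 - α) * (n * (σ - η))) * _ :=
        mul_le_mul_of_nonneg_left hc (by positivity)
    _ = _ := Finset.mul_sum _ _ _
    _ ≤ ∑ f ∈ Finset.univ.filter (fun f : Fin n → I => |pathSum l f - n * m| ≤ n * η),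
          kpow b n f * min (Real.exp (pathSum l f)) (Real.exp (n * τ)) := by
        refine Finset.sum_le_sum fun f hf => ?_
        obtain ⟨hl, hu⟩ := abs_le.mp (Finset.mem_filter.mp hf).2
        have hlow : n * (σ - η) ≤ pathSum l f := by nlinarith
        calc _ = kpow b n f * (Real.exp ((1 - α) * (n * (σ - η)) + α * pathSum l f)) := by
              rw [Real.exp_add]; ring
          _ ≤ _ := by
              refine mul_le_mul_of_nonneg_left (le_min ?_ ?_) (kpow_nonneg hb n f)
              · exact Real.exp_le_exp.mpr (by nlinarith)
              · refine Real.exp_le_exp.mpr ?_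
                rcases hτ with h | ⟨h0, h⟩
                · subst h; nlinarith
                · have : pathSum l f ≤ n * τ := by nlinarith
                  nlinarith
    _ ≤ _ := Finset.sum_le_sum_of_subset_of_nonneg (Finset.filter_subset _ _)
        fun f _ _ => mul_nonneg (kpow_nonneg hb n f)
          (le_min (Real.exp_pos _).le (Real.exp_pos _).le)

lemma pathExcess_eq_zero {b : I → ℝ} {l : I → ℝ} {n : ℕ} {ρ τ : ℝ}
    (hρ : ∀ x, b x ≠ 0 → l x ≤ ρ) (hτ : ρ ≤ τ) : pathExcess b l n (Real.exp (n * τ)) = 0 := by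
  refine Finset.sum_eq_zero fun f _ => ?_
  by_cases h : kpow b n f = 0
  · rw [h, zero_mul]
  · have hne : ∀ j, b (f j) ≠ 0 := fun j => Finset.prod_ne_zero_iff.mp h j (Finset.mem_univ j)
    have : pathSum l f ≤ n * τ := by
      calc pathSum l f ≤ ∑ _j : Fin n, ρ := Finset.sum_le_sum fun j _ => hρ _ (hne j)
        _ = n * ρ := by simp
        _ ≤ n * τ := mul_le_mul_of_nonneg_left hτ (Nat.cast_nonneg n)
    rw [max_eq_right (sub_nonpos.mpr (Real.exp_le_exp.mpr this)), mul_zero]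

/-- The tilted mean approaches the top of the range. -/
lemma exists_lt_tiltMean {b : I → ℝ} (hb : ∀ x, 0 ≤ b x) {l : I → ℝ} (h1 : tiltSum b l 1 = 1)
    {x₀ : I} (hx₀ : 0 < b x₀) {ρ : ℝ} (hρ : ρ < l x₀) : ∃ α, 2 < α ∧ ρ < tiltMean b l α := by
  set Λ := fun α => Real.log (tiltSum b l α) with hΛ
  set K := |Λ 2 - Real.log (b x₀) - 2 * l x₀| with hK
  have hd : 0 < l x₀ - ρ := sub_pos.mpr hρ
  obtain ⟨A, hA⟩ : ∃ A : ℝ, A = 2 + (K + 1) / (l x₀ - ρ) := ⟨_, rfl⟩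
  have hK0 : 0 ≤ K := abs_nonneg _
  have hA2 : 2 < A := by rw [hA]; linarith [div_pos (by linarith : 0 < K + 1) hd]
  have hAK : (A - 2) * (l x₀ - ρ) = K + 1 := by rw [hA]; field_simp; ring
  obtain ⟨ξ, hξ, hξ'⟩ := exists_hasDerivAt_eq_slope Λ (tiltMean b l) hA2
    (fun α _ => (hasDerivAt_log_tiltSum hb h1 α).continuousAt.continuousWithinAt)
    (fun α _ => hasDerivAt_log_tiltSum hb h1 α)
  refine ⟨ξ, hξ.1, ?_⟩
  have hΛA : Real.log (b x₀) + A * l x₀ ≤ Λ A := by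
    have : b x₀ * Real.exp (A * l x₀) ≤ tiltSum b l A :=
      Finset.single_le_sum (f := fun x => b x * Real.exp (A * l x))
        (fun x _ => mul_nonneg (hb x) (Real.exp_pos _).le) (Finset.mem_univ x₀)
    have h2 := Real.log_le_log (mul_pos hx₀ (Real.exp_pos _)) this
    rwa [Real.log_mul hx₀.ne' (Real.exp_pos _).ne', Real.log_exp] at h2
  rw [hξ', lt_div_iff₀ (by linarith)]
  have := le_abs_self (Λ 2 - Real.log (b x₀) - 2 * l x₀)
  rw [← hK] at this
  nlinarith

/-- Strict ordering of all exponential moments, of the means and of the maxima forces the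
ordering of the hockey-stick functionals of all large powers. -/
theorem eventually_pathExcess_le {b l : I → ℝ} {b' l' : J → ℝ}
    (hb : ∀ x, 0 ≤ b x) (hb' : ∀ y, 0 ≤ b' y)
    (h1 : tiltSum b l 1 = 1) (h1' : tiltSum b' l' 1 = 1)
    (hlow : ∀ α, 0 ≤ α → α < 1 → tiltSum b l α < tiltSum b' l' α)
    (hhigh : ∀ α, 1 < α → tiltSum b' l' α < tiltSum b l α)
    (hmean : tiltMean b' l' 1 < tiltMean b l 1)
    {x₀ : I} (hx₀ : 0 < b x₀) {ρ : ℝ} (hρ : ρ < l x₀) (hρ' : ∀ y, b' y ≠ 0 → l' y ≤ ρ) :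
    ∃ N : ℕ, ∀ n ≥ N, ∀ t : ℝ, 0 ≤ t → pathExcess b' l' n t ≤ pathExcess b l n t := by
  have hS := tiltSum_pos hb h1
  have hS' := tiltSum_pos hb' h1'
  obtain ⟨A, hA2, hA⟩ := exists_lt_tiltMean hb h1 hx₀ (ρ := (ρ + l x₀) / 2) (by linarith)
  have hder : ∀ α, HasDerivAt (fun α =>
      Real.log (tiltSum b l α) - Real.log (tiltSum b' l' α))
      (tiltMean b l α - tiltMean b' l' α) α := fun α =>
    (hasDerivAt_log_tiltSum hb h1 α).sub (hasDerivAt_log_tiltSum hb' h1' α)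
  obtain ⟨c, hc0, hcgap⟩ : ∃ c > 0, ∀ α ∈ Set.Icc 0 A, c ≤ dslope (fun α =>
      Real.log (tiltSum b l α) - Real.log (tiltSum b' l' α)) 1 α := by
    have hcont : Continuous (dslope (fun α =>
        Real.log (tiltSum b l α) - Real.log (tiltSum b' l' α)) 1) := by
      rw [← continuousOn_univ]
      refine (continuousOn_dslope Filter.univ_mem).mpr
        ⟨fun α _ => (hder α).continuousAt.continuousWithinAt, (hder 1).differentiableAt⟩
    obtain ⟨α₀, hα₀, hmin⟩ := isCompact_Icc.exists_isMinOn
      (Set.nonempty_Icc.mpr (by linarith : (0 : ℝ) ≤ A)) hcont.continuousOn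
    refine ⟨_, ?_, fun α hα => hmin hα⟩
    rcases eq_or_ne α₀ 1 with h | h
    · rw [h, dslope_same, (hder 1).deriv]; linarith
    · rw [dslope_of_ne _ h, slope_def_field, h1, h1']
      rcases lt_or_gt_of_ne h with h | h
      · have := Real.log_lt_log (hS α₀) (hlow α₀ hα₀.1 h)
        refine div_pos_of_neg_of_neg ?_ (by linarith)
        simp only [Real.log_one]; linarith
      · have := Real.log_lt_log (hS' α₀) (hhigh α₀ h)
        refine div_pos ?_ (by linarith)
        simp only [Real.log_one]; linarith
  obtain ⟨η, hη0, hη1, hη2⟩ : ∃ η > 0, 8 * η ≤ c ∧ 8 * η ≤ l x₀ - ρ :=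
    ⟨min c (l x₀ - ρ) / 8, by have := lt_min hc0 (sub_pos.mpr hρ); linarith,
      by linarith [min_le_left c (l x₀ - ρ)], by linarith [min_le_right c (l x₀ - ρ)]⟩
  have hgapD : tiltMean b' l' 1 + 8 * η ≤ tiltMean b l 1 := by
    have := hcgap 1 ⟨by norm_num, by linarith⟩
    rw [dslope_same, (hder 1).deriv] at this
    linarith
  have hgapS : ∀ α ∈ Set.Icc 1 A, tiltSum b' l' α ≤ tiltSum b l α * Real.exp (-(8 * η * (α - 1)))
      := by
    intro α hα
    rcases hα.1.eq_or_lt with h | h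
    · rw [← h, h1, h1']; simp
    · have := hcgap α ⟨by linarith, hα.2⟩
      rw [dslope_of_ne _ h.ne', slope_def_field, h1, h1', le_div_iff₀ (by linarith)] at this
      rw [← Real.exp_log (hS α), ← Real.exp_log (hS' α), ← Real.exp_add, Real.exp_le_exp]
      simp only [Real.log_one] at this
      nlinarith
  have hgapS' : ∀ α ∈ Set.Icc 0 1, tiltSum b l α ≤ tiltSum b' l' α * Real.exp (-(8 * η * (1 - α)))
      := by
    intro α hα
    rcases hα.2.eq_or_lt with h | h
    · rw [h, h1, h1']; simp
    · have := hcgap α ⟨hα.1, by linarith⟩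
      rw [dslope_of_ne _ h.ne, slope_def_field, h1, h1', le_div_iff_of_neg (by linarith)] at this
      rw [← Real.exp_log (hS α), ← Real.exp_log (hS' α), ← Real.exp_add, Real.exp_le_exp]
      simp only [Real.log_one] at this
      nlinarith
  -- a window around `1` on which the tilted means barely move
  obtain ⟨κ, hκ0, hκ1, hκ, hκ'⟩ : ∃ κ > 0, κ ≤ 1 ∧ tiltMean b l (1 + κ) < tiltMean b l 1 + 2 * η ∧
      tiltMean b' l' 1 - 2 * η < tiltMean b' l' (1 - κ) := by
    have e1 : ∀ᶠ κ in nhds (0 : ℝ), tiltMean b l (1 + κ) < tiltMean b l 1 + 2 * η := by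
      have : Continuous fun κ => tiltMean b l (1 + κ) :=
        (continuous_tiltMean hb h1).comp (by fun_prop)
      refine this.continuousAt.eventually_lt continuousAt_const ?_
      simp only [add_zero]; linarith
    have e2 : ∀ᶠ κ in nhds (0 : ℝ), tiltMean b' l' 1 - 2 * η < tiltMean b' l' (1 - κ) := by
      have : Continuous fun κ => tiltMean b' l' (1 - κ) :=
        (continuous_tiltMean hb' h1').comp (by fun_prop)
      refine continuousAt_const.eventually_lt this.continuousAt ?_
      simp only [sub_zero]; linarith
    have e3 : ∀ᶠ κ in nhds (0 : ℝ), κ < 1 := eventually_lt_nhds one_pos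
    obtain ⟨κ, ⟨⟨h1, h2⟩, h3⟩, h0⟩ :=
      ((((e1.and e2).and e3).filter_mono nhdsWithin_le_nhds).and
        (self_mem_nhdsWithin (a := (0 : ℝ)) (s := Set.Ioi 0))).exists
    exact ⟨κ, h0, h3.le, h1, h2⟩
  obtain ⟨N₁, hN₁⟩ := tilt_concentration hb h1 hη0
  obtain ⟨N₂, hN₂⟩ := tilt_concentration hb' h1' hη0
  have hexp : ∀ a : ℝ, 0 < a → ∃ N : ℕ, ∀ n ≥ N, Real.exp (-(n * a)) ≤ 1 / 3 := by
    intro a ha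
    obtain ⟨N, hN⟩ := exists_nat_ge (Real.log 3 / a)
    refine ⟨N, fun n hn => ?_⟩
    have : Real.log 3 ≤ n * a := by
      rw [div_le_iff₀ ha] at hN
      exact hN.trans (mul_le_mul_of_nonneg_right (by exact_mod_cast hn) ha.le)
    calc Real.exp (-(n * a)) ≤ Real.exp (-Real.log 3) := Real.exp_le_exp.mpr (by linarith)
      _ = 1 / 3 := by rw [Real.exp_neg, Real.exp_log (by norm_num)]; norm_num
  obtain ⟨N₃, hN₃⟩ := hexp η hη0
  obtain ⟨N₄, hN₄⟩ := hexp (3 * η * κ) (by positivity)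
  refine ⟨N₁ + N₂ + N₃ + N₄ + 1, fun n hn t ht => ?_⟩
  have hn0 : (0 : ℝ) < n := by exact_mod_cast (by omega : 0 < n)
  rcases ht.eq_or_lt with ht | ht
  · have key : ∀ {K : Type} [Fintype K] {b l : K → ℝ}, tiltSum b l 1 = 1 →
        pathExcess b l n 0 = 1 := by
      intro K _ b l h
      have := sum_kpow_tilt b l 1 n
      rw [h, one_pow] at this
      rw [pathExcess, ← this]
      refine Finset.sum_congr rfl fun f _ => ?_
      rw [sub_zero, one_mul, max_eq_left (Real.exp_pos _).le]
    rw [← ht, key h1, key h1']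
  obtain ⟨τ, rfl⟩ : ∃ τ, t = Real.exp (n * τ) :=
    ⟨Real.log t / n, by rw [mul_div_cancel₀ _ hn0.ne', Real.exp_log ht]⟩
  rcases le_or_gt ρ τ with hτρ | hτρ
  · rw [pathExcess_eq_zero hρ' hτρ]
    exact pathExcess_nonneg hb l n _
  have c₁ := hN₁ n (by omega)
  have c₂ := hN₂ n (by omega)
  have c₃ := hN₃ n (by omega)
  have c₄ := hN₄ n (by omega)
  have compl := pathExcess_add_pathOverlap h1 n (Real.exp (n * τ))
  have compl' := pathExcess_add_pathOverlap h1' n (Real.exp (n * τ))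
  rcases le_or_gt (tiltMean b l 1 - 2 * η) τ with hup | hup
  · -- upper tail
    obtain ⟨α, hα, hαm⟩ : ∃ α ∈ Set.Icc (1 + κ) A, tiltMean b l α = τ + 4 * η := by
      refine intermediate_value_Icc (by linarith) (continuous_tiltMean hb h1).continuousOn ⟨?_, ?_⟩
      · linarith
      · linarith
    have hα1 : 1 + κ ≤ α := hα.1
    have hlo := le_pathExcess hb l (by linarith : 1 ≤ α) (c₁ α) c₃ (τ := τ) (by linarith)
    have hhi := pathExcess_le hb' l' n (n * τ) (by linarith : 1 ≤ α)
    refine hhi.trans (le_trans ?_ hlo)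
    have hg := pow_le_pow_left₀ (hS' α).le (hgapS α ⟨by linarith, hα.2⟩) n
    rw [mul_pow, ← Real.exp_nat_mul] at hg
    calc _ ≤ tiltSum b l α ^ n * Real.exp (n * -(8 * η * (α - 1)))
          * Real.exp ((1 - α) * (n * τ)) := mul_le_mul_of_nonneg_right hg (Real.exp_pos _).le
      _ = tiltSum b l α ^ n * (Real.exp (n * -(8 * η * (α - 1)))
          * Real.exp ((1 - α) * (n * τ))) := by ring
      _ ≤ tiltSum b l α ^ n * (1 / 2 * Real.exp ((1 - α) * (n * (tiltMean b l α + η)))) := by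
          refine mul_le_mul_of_nonneg_left ?_ (pow_pos (hS α) n).le
          calc _ ≤ Real.exp (-(n * (3 * η * κ)))
                  * Real.exp ((1 - α) * (n * (tiltMean b l α + η))) := by
                rw [← Real.exp_add, ← Real.exp_add, hαm]
                refine Real.exp_le_exp.mpr ?_
                have : 0 ≤ n * η * (α - 1 - κ) := by
                  have : 0 ≤ α - 1 - κ := by linarith
                  positivity
                nlinarith
            _ ≤ _ := mul_le_mul_of_nonneg_right (by linarith) (Real.exp_pos _).le
      _ = _ := by ring
  rcases le_or_gt (tiltMean b' l' 1 + 2 * η) τ with hmid | hmid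
  · -- bulk
    have hlo := le_pathExcess hb l le_rfl (c₁ 1) c₃ (τ := τ) (by linarith)
    have hlo' := le_pathOverlap hb' l' le_rfl (c₂ 1) (τ := τ) le_rfl (by linarith)
      (Or.inr ⟨zero_le_one, by linarith⟩)
    simp only [h1, h1', one_pow, sub_self, zero_mul, Real.exp_zero] at hlo hlo'
    linarith
  · -- lower tail
    suffices pathOverlap b l n (Real.exp (n * τ)) ≤ pathOverlap b' l' n (Real.exp (n * τ)) by
      linarith
    obtain ⟨α, hα, hαm, hα'⟩ : ∃ α ∈ Set.Icc 0 (1 - κ), τ - 4 * η ≤ tiltMean b' l' α ∧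
        (α = 0 ∨ 0 ≤ α ∧ tiltMean b' l' α + η ≤ τ) := by
      rcases le_or_gt (τ - 4 * η) (tiltMean b' l' 0) with h | h
      · exact ⟨0, ⟨le_rfl, by linarith⟩, h, Or.inl rfl⟩
      · obtain ⟨α, hα, hαm⟩ := intermediate_value_Icc (by linarith : (0 : ℝ) ≤ 1 - κ)
          (continuous_tiltMean hb' h1').continuousOn ⟨h.le, by linarith⟩
        exact ⟨α, hα, hαm.ge, Or.inr ⟨hα.1, by linarith⟩⟩
    have hα1 : α ≤ 1 - κ := hα.2
    have hlo := le_pathOverlap hb' l' (by linarith : α ≤ 1) (c₂ α) hαm (by linarith) hα'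
    have hhi := pathOverlap_le hb l n (n * τ) hα.1 (by linarith : α ≤ 1)
    refine hhi.trans (le_trans ?_ hlo)
    have hg := pow_le_pow_left₀ (hS α).le (hgapS' α ⟨hα.1, by linarith⟩) n
    rw [mul_pow, ← Real.exp_nat_mul] at hg
    calc _ ≤ tiltSum b' l' α ^ n * Real.exp (n * -(8 * η * (1 - α)))
          * Real.exp ((1 - α) * (n * τ)) := mul_le_mul_of_nonneg_right hg (Real.exp_pos _).le
      _ = tiltSum b' l' α ^ n * (Real.exp (n * -(8 * η * (1 - α)))
          * Real.exp ((1 - α) * (n * τ))) := by ring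
      _ ≤ tiltSum b' l' α ^ n * (1 / 2 * Real.exp ((1 - α) * (n * (τ - 4 * η - η)))) := by
          refine mul_le_mul_of_nonneg_left ?_ (pow_pos (hS' α) n).le
          calc _ ≤ Real.exp (-(n * (3 * η * κ)))
                  * Real.exp ((1 - α) * (n * (τ - 4 * η - η))) := by
                rw [← Real.exp_add, ← Real.exp_add]
                refine Real.exp_le_exp.mpr ?_
                have : 0 ≤ n * η * (1 - α - κ) := by
                  have : 0 ≤ 1 - α - κ := by linarith
                  positivity
                nlinarith
            _ ≤ _ := mul_le_mul_of_nonneg_right (by linarith) (Real.exp_pos _).le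
      _ = _ := by ring

end LargeDeviationsComparison

/-- The `f`-divergence `∑ q g(p/q)`. -/
def fDiv {I : Type} [Fintype I] (g : ℝ → ℝ) (p q : I → ℝ) : ℝ := ∑ x, q x * g (p x / q x)

section Blackwell

variable {I J : Type} [Fintype I] [Fintype J]

lemma IsDichotomy.mul_div {p q : I → ℝ} (h : IsDichotomy p q) (x : I) : q x * (p x / q x) = p x := by
  by_cases hx : q x = 0
  · have : p x = 0 := by_contra fun h' => h.2.2 x h' hx
    rw [hx, this, zero_mul]
  · field_simp

lemma IsDichotomy.div_nonneg {p q : I → ℝ} (h : IsDichotomy p q) (x : I) : 0 ≤ p x / q x :=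
  _root_.div_nonneg (h.1.1 x) (h.2.1.1 x)

lemma fDiv_affine {p q : I → ℝ} (h : IsDichotomy p q) (α β : ℝ) :
    fDiv (fun s => α + β * s) p q = α + β := by
  have : ∀ x, q x * (α + β * (p x / q x)) = α * q x + β * p x := fun x => by
    linear_combination β * h.mul_div x
  simp only [fDiv, this, Finset.sum_add_distrib, ← Finset.mul_sum, h.1.2, h.2.1.2, mul_one]

lemma fDiv_add (g₁ g₂ : ℝ → ℝ) (p q : I → ℝ) :
    fDiv (fun s => g₁ s + g₂ s) p q = fDiv g₁ p q + fDiv g₂ p q := by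
  simp only [fDiv, mul_add, Finset.sum_add_distrib]

lemma fDiv_const_mul (c : ℝ) (g : ℝ → ℝ) (p q : I → ℝ) :
    fDiv (fun s => c * g s) p q = c * fDiv g p q := by
  simp only [fDiv, Finset.mul_sum]
  exact Finset.sum_congr rfl fun x _ => by ring

lemma fDiv_hockeyStick {p q : I → ℝ} (h : IsDichotomy p q) (t : ℝ) :
    fDiv (fun s => max (s - t) 0) p q = ∑ x, max (p x - t * q x) 0 := by
  refine Finset.sum_congr rfl fun x _ => ?_
  dsimp only
  rw [mul_max_of_nonneg _ _ (h.2.1.1 x), mul_sub, h.mul_div, mul_zero, mul_comm]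

/-- A convex function is interpolated on a finite set by an affine function plus a nonnegative
combination of hockey-stick functions with kinks in that set; `P` is any property that is
preserved when such functions are formed. -/
lemma exists_interpolation {f : ℝ → ℝ} (hf : ConvexOn ℝ Set.univ f) {P : (ℝ → ℝ) → Prop}
    (haff : ∀ α β : ℝ, P fun s => α + β * s) (S : Finset ℝ)
    (hkink : ∀ g, P g → ∀ c m : ℝ, 0 ≤ c → m ∈ S → P fun s => g s + c * max (s - m) 0) :
    ∃ g, P g ∧ ∀ s ∈ S, g s = f s := by
  suffices H : ∀ S' ⊆ S, S'.Nonempty → ∃ m ∈ S', (∀ s ∈ S', s ≤ m) ∧ ∃ g, P g ∧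
      (∀ s ∈ S', g s = f s) ∧ ∃ σ, (∀ s, m ≤ s → g s = f m + σ * (s - m)) ∧
        ∀ z, m < z → σ * (z - m) ≤ f z - f m by
    rcases S.eq_empty_or_nonempty with h | h
    · exact ⟨_, haff 0 0, by simp [h]⟩
    · obtain ⟨_, _, _, g, hg, hgs, _⟩ := H S subset_rfl h
      exact ⟨g, hg, hgs⟩
  intro S'
  induction S' using Finset.induction_on_max with
  | empty => exact fun _ h => absurd h (by simp)
  | insert z S' hz ih =>
    intro hsub _
    refine ⟨z, Finset.mem_insert_self _ _, fun s hs => ?_, ?_⟩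
    · rcases Finset.mem_insert.mp hs with h | h
      · exact h.le
      · exact (hz s h).le
    rcases S'.eq_empty_or_nonempty with h | h
    · subst h
      refine ⟨_, haff (f z - (f z - f (z - 1)) * z) (f z - f (z - 1)), ?_, f z - f (z - 1), ?_, ?_⟩
      · intro s hs
        obtain rfl : s = z := by simpa using hs
        ring
      · intro s _; ring
      · intro w hw
        have := hf.slope_mono_adjacent (Set.mem_univ (z - 1)) (Set.mem_univ w)
          (by linarith : z - 1 < z) hw
        rw [sub_sub_cancel, div_one, le_div_iff₀ (by linarith)] at this
        exact this
    · obtain ⟨m, hm, hmax, g, hPg, hgs, σ, hσ, hslope⟩ :=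
        ih ((Finset.subset_insert _ _).trans hsub) h
      have hmz : 0 < z - m := sub_pos.mpr (hz m hm)
      set σ' := (f z - f m) / (z - m) with hσ'
      have hσz : σ' * (z - m) = f z - f m := div_mul_cancel₀ _ hmz.ne'
      have hle : σ ≤ σ' := (le_div_iff₀ hmz).mpr (hslope z (by linarith))
      refine ⟨_, hkink g hPg (σ' - σ) m (sub_nonneg.mpr hle)
        (hsub (Finset.mem_insert_of_mem hm)), ?_, σ', ?_, ?_⟩
      · intro s hs
        rcases Finset.mem_insert.mp hs with rfl | hs
        · rw [max_eq_left hmz.le, hσ _ (by linarith)]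
          linear_combination hσz
        · rw [max_eq_right (by linarith [hmax s hs]), hgs s hs, mul_zero, add_zero]
      · intro s hs
        rw [max_eq_left (by linarith), hσ s (by linarith)]
        linear_combination hσz
      · intro w hw
        have := hf.slope_mono_adjacent (Set.mem_univ m) (Set.mem_univ w) (by linarith : m < z) hw
        rw [← hσ', le_div_iff₀ (by linarith)] at this
        exact this

/-- Domination of hockey-stick functionals implies domination of every `f`-divergence. -/
lemma fDiv_le_of_hockeyStick_le {p₁ p₂ : I → ℝ} {q₁ q₂ : J → ℝ} (hp : IsDichotomy p₁ p₂)
    (hq : IsDichotomy q₁ q₂)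
    (h : ∀ t : ℝ, 0 ≤ t → ∑ y, max (q₁ y - t * q₂ y) 0 ≤ ∑ x, max (p₁ x - t * p₂ x) 0)
    {f : ℝ → ℝ} (hf : ConvexOn ℝ Set.univ f) : fDiv f q₁ q₂ ≤ fDiv f p₁ p₂ := by
  obtain ⟨g, hg, hgf⟩ := exists_interpolation hf (P := fun g => fDiv g q₁ q₂ ≤ fDiv g p₁ p₂)
    (fun α β => by rw [fDiv_affine hp, fDiv_affine hq])
    (Finset.univ.image (fun x => p₁ x / p₂ x) ∪ Finset.univ.image (fun y => q₁ y / q₂ y))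
    (fun g hg c m hc hm => by
      rw [fDiv_add g (fun s => c * max (s - m) 0), fDiv_add g (fun s => c * max (s - m) 0),
        fDiv_const_mul, fDiv_const_mul, fDiv_hockeyStick hp, fDiv_hockeyStick hq]
      refine add_le_add hg (mul_le_mul_of_nonneg_left (h m ?_) hc)
      rcases Finset.mem_union.mp hm with hm | hm
      · obtain ⟨x, _, rfl⟩ := Finset.mem_image.mp hm
        exact hp.div_nonneg x
      · obtain ⟨y, _, rfl⟩ := Finset.mem_image.mp hm
        exact hq.div_nonneg y)
  have e1 : fDiv g q₁ q₂ = fDiv f q₁ q₂ := Finset.sum_congr rfl fun y _ => by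
    rw [hgf _ (Finset.mem_union_right _ (Finset.mem_image_of_mem _ (Finset.mem_univ y)))]
  have e2 : fDiv g p₁ p₂ = fDiv f p₁ p₂ := Finset.sum_congr rfl fun x _ => by
    rw [hgf _ (Finset.mem_union_left _ (Finset.mem_image_of_mem _ (Finset.mem_univ x)))]
  rwa [e1, e2] at hg

/-- Blackwell's theorem for finite dichotomies. -/
theorem exists_isStoch_of_hockeyStick_le {p₁ p₂ : I → ℝ} {q₁ q₂ : J → ℝ}
    (hp : IsDichotomy p₁ p₂) (hq : IsDichotomy q₁ q₂)
    (h : ∀ t : ℝ, 0 ≤ t → ∑ y, max (q₁ y - t * q₂ y) 0 ≤ ∑ x, max (p₁ x - t * p₂ x) 0) :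
    ∃ T : J → I → ℝ, IsStoch T ∧ (∀ y, ∑ x, T y x * p₁ x = q₁ y) ∧
      ∀ y, ∑ x, T y x * p₂ x = q₂ y := by
  have hJ : Nonempty J := by
    by_contra hJ
    rw [not_nonempty_iff] at hJ
    exact absurd hq.1.2 (by simp)
  let φ : (I → J → ℝ) →ₗ[ℝ] (J → ℝ) × (J → ℝ) :=
    { toFun := fun T => (fun y => ∑ x, T x y * p₁ x, fun y => ∑ x, T x y * p₂ x)
      map_add' := fun T T' => by
        ext y <;> simp [add_mul, Finset.sum_add_distrib]
      map_smul' := fun c T => by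
        ext y <;> simp [Finset.mul_sum, mul_assoc] }
  let C : Set (I → J → ℝ) := Set.univ.pi fun _ => stdSimplex ℝ J
  have hCc : IsCompact C := isCompact_univ_pi fun _ => isCompact_stdSimplex ℝ J
  have hCx : Convex ℝ C := convex_pi fun _ _ => convex_stdSimplex ℝ J
  by_cases hmem : ((q₁, q₂) : (J → ℝ) × (J → ℝ)) ∈ φ '' C
  · obtain ⟨T, hT, hTq⟩ := hmem
    refine ⟨fun y x => T x y, ⟨fun y x => (hT x trivial).1 y, fun x => (hT x trivial).2⟩, ?_, ?_⟩
    · exact fun y => congrFun (congrArg Prod.fst hTq) y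
    · exact fun y => congrFun (congrArg Prod.snd hTq) y
  exfalso
  have hφ : Continuous φ := φ.continuous_of_finiteDimensional
  obtain ⟨F, u, hF, hu⟩ := geometric_hahn_banach_closed_point (hCx.linear_image φ)
    (hCc.image hφ).isClosed hmem
  set a : J → ℝ := fun y => F (Pi.single y 1, 0)
  set c : J → ℝ := fun y => F (0, Pi.single y 1)
  have hrep : ∀ v w : J → ℝ, F (v, w) = ∑ y, (v y * a y + w y * c y) := by
    intro v w
    have : ((v, w) : (J → ℝ) × (J → ℝ)) = ∑ y, (v y • ((Pi.single y 1, 0) : (J → ℝ) × (J → ℝ))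
        + w y • ((0, Pi.single y 1) : (J → ℝ) × (J → ℝ))) := by
      ext z
      · simp [Prod.fst_sum, Finset.sum_apply, Pi.single_apply]
      · simp [Prod.snd_sum, Finset.sum_apply, Pi.single_apply]
    rw [this, map_sum]
    simp only [map_add, map_smul, smul_eq_mul, a, c]
  let f : ℝ → ℝ := fun s => Finset.univ.sup' Finset.univ_nonempty fun y => a y * s + c y
  have hf : ConvexOn ℝ Set.univ f := by
    refine ⟨convex_univ, fun s _ t _ α β hα hβ hαβ => ?_⟩
    refine Finset.sup'_le _ _ fun y _ => ?_
    have h1 : a y * s + c y ≤ f s :=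
      Finset.le_sup' (fun y => a y * s + c y) (Finset.mem_univ y)
    have h2 : a y * t + c y ≤ f t :=
      Finset.le_sup' (fun y => a y * t + c y) (Finset.mem_univ y)
    simp only [smul_eq_mul]
    calc a y * (α * s + β * t) + c y = α * (a y * s + c y) + β * (a y * t + c y) := by
          linear_combination (-c y) * hαβ
      _ ≤ _ := by gcongr
  have hdiv := fDiv_le_of_hockeyStick_le hp hq h hf
  have hq' : F (q₁, q₂) ≤ fDiv f q₁ q₂ := by
    rw [hrep]
    refine Finset.sum_le_sum fun y _ => ?_
    calc q₁ y * a y + q₂ y * c y = q₂ y * (a y * (q₁ y / q₂ y) + c y) := by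
          linear_combination (-a y) * hq.mul_div y
      _ ≤ _ := mul_le_mul_of_nonneg_left
          (Finset.le_sup' (fun z => a z * (q₁ y / q₂ y) + c z) (Finset.mem_univ y)) (hq.2.1.1 y)
  have hargmax : ∀ x, ∃ y, f (p₁ x / p₂ x) = a y * (p₁ x / p₂ x) + c y := fun x => by
    obtain ⟨y, _, hy⟩ := Finset.exists_mem_eq_sup' (Finset.univ_nonempty (α := J))
      (fun y => a y * (p₁ x / p₂ x) + c y)
    exact ⟨y, hy⟩
  choose m hm using hargmax
  have hT : (fun x => Pi.single (m x) 1 : I → J → ℝ) ∈ C := fun x _ =>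
    single_mem_stdSimplex ℝ (m x)
  have hp' : F (φ fun x => Pi.single (m x) 1) = fDiv f p₁ p₂ := by
    have : φ (fun x => Pi.single (m x) 1) = (fun y => ∑ x, (Pi.single (m x) 1 : J → ℝ) y * p₁ x,
        fun y => ∑ x, (Pi.single (m x) 1 : J → ℝ) y * p₂ x) := rfl
    rw [this, hrep]
    simp only [Finset.sum_mul, ← Finset.sum_add_distrib]
    rw [Finset.sum_comm]
    refine Finset.sum_congr rfl fun x _ => ?_
    rw [Finset.sum_eq_single (m x)]
    · rw [Pi.single_eq_same, hm]
      linear_combination (-a (m x)) * hp.mul_div x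
    · intro y _ hy
      rw [Pi.single_eq_of_ne hy]; ring
    · simp
  have := hF _ ⟨_, hT, rfl⟩
  linarith

end Blackwell

/-- The weight `q` restricted to the support of `p`. -/
def suppWeight {I : Type} (p q : I → ℝ) : I → ℝ := fun x => if p x ≠ 0 then q x else 0

/-- The log-likelihood ratio. -/
def logRatio {I : Type} (p q : I → ℝ) : I → ℝ := fun x => Real.log (p x / q x)

section Dichotomy

variable {I J : Type} [Fintype I] [Fintype J] {p q : I → ℝ}

lemma suppWeight_nonneg (h : IsDichotomy p q) (x : I) : 0 ≤ suppWeight p q x := by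
  unfold suppWeight; split_ifs
  · exact h.2.1.1 x
  · exact le_rfl

lemma IsDichotomy.snd_pos (h : IsDichotomy p q) {x : I} (hx : p x ≠ 0) : 0 < q x :=
  (h.2.1.1 x).lt_of_ne' (h.2.2 x hx)

lemma IsDichotomy.div_pos (h : IsDichotomy p q) {x : I} (hx : p x ≠ 0) : 0 < p x / q x :=
  _root_.div_pos ((h.1.1 x).lt_of_ne' hx) (h.snd_pos hx)

lemma suppWeight_mul_exp (h : IsDichotomy p q) (x : I) :
    suppWeight p q x * Real.exp (logRatio p q x) = p x := by
  unfold suppWeight logRatio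
  split_ifs with hx
  · rw [Real.exp_log (h.div_pos hx), h.mul_div]
  · rw [zero_mul, not_not.mp hx]

lemma tiltSum_suppWeight (h : IsDichotomy p q) {α : ℝ} (hα : 0 < α) :
    tiltSum (suppWeight p q) (logRatio p q) α = fDiv (fun s => s ^ α) p q := by
  refine Finset.sum_congr rfl fun x _ => ?_
  simp only [suppWeight, logRatio]
  split_ifs with hx
  · rw [Real.rpow_def_of_pos (h.div_pos hx), mul_comm α]
  · rw [not_not.mp hx, zero_mul, zero_div, Real.zero_rpow hα.ne', mul_zero]

lemma tiltSum_suppWeight_one (h : IsDichotomy p q) :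
    tiltSum (suppWeight p q) (logRatio p q) 1 = 1 := by
  simp only [tiltSum, one_mul, suppWeight_mul_exp h, h.1.2]

lemma sum_suppWeight_mul_exp_mul (h : IsDichotomy p q) :
    ∑ x, suppWeight p q x * Real.exp (1 * logRatio p q x) * logRatio p q x
      = fDiv (fun s => s * Real.log s) p q := by
  refine Finset.sum_congr rfl fun x _ => ?_
  rw [one_mul, suppWeight_mul_exp h, ← mul_assoc, h.mul_div, logRatio]

lemma tiltMean_suppWeight_one (h : IsDichotomy p q) :
    tiltMean (suppWeight p q) (logRatio p q) 1 = fDiv (fun s => s * Real.log s) p q := by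
  rw [tiltMean, tiltSum_suppWeight_one h, div_one, sum_suppWeight_mul_exp_mul h]

lemma fDiv_rpow_pos (h : IsDichotomy p q) {α : ℝ} (hα : 0 < α) :
    0 < fDiv (fun s => s ^ α) p q := by
  rw [← tiltSum_suppWeight h hα]
  exact tiltSum_pos (suppWeight_nonneg h) (tiltSum_suppWeight_one h) α

lemma sum_max_kpow (h : IsDichotomy p q) (n : ℕ) {t : ℝ} (ht : 0 ≤ t) :
    ∑ f, max (kpow p n f - t * kpow q n f) 0
      = pathExcess (suppWeight p q) (logRatio p q) n t := by
  refine Finset.sum_congr rfl fun f _ => ?_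
  have hk := kpow_tilt (suppWeight p q) (logRatio p q) 1 n f
  simp only [one_mul, suppWeight_mul_exp h] at hk
  have hk' : kpow p n f = kpow (suppWeight p q) n f * Real.exp (pathSum (logRatio p q) f) := hk
  by_cases hf : kpow p n f = 0
  · have h0 : kpow (suppWeight p q) n f = 0 :=
      (mul_eq_zero.mp (hk'.symm.trans hf)).resolve_right (Real.exp_pos _).ne'
    rw [h0, zero_mul, hf, max_eq_right]
    have := mul_nonneg ht (kpow_nonneg h.2.1.1 n f)
    linarith
  · have hq : kpow (suppWeight p q) n f = kpow q n f := by
      refine Finset.prod_congr rfl fun j _ => ?_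
      exact if_pos (Finset.prod_ne_zero_iff.mp hf j (Finset.mem_univ j))
    rw [hk', hq, mul_max_of_nonneg _ _ (kpow_nonneg h.2.1.1 n f), mul_zero, mul_sub,
      mul_comm t]

lemma IsDichotomy.kron {r₁ r₂ : J → ℝ} (hr : IsDichotomy r₁ r₂) (h : IsDichotomy p q) :
    IsDichotomy (kron r₁ p) (kron r₂ q) := by
  have key : ∀ {K L : Type} [Fintype K] [Fintype L] {u : K → ℝ} {v : L → ℝ}, IsProb u →
      IsProb v → IsProb (_root_.kron u v) := fun hu hv =>
    ⟨fun x => mul_nonneg (hu.1 _) (hv.1 _), by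
      simp only [_root_.kron, Fintype.sum_prod_type, ← Finset.mul_sum, hv.2, mul_one, hu.2]⟩
  exact ⟨key hr.1 h.1, key hr.2.1 h.2.1, fun x hx =>
    mul_ne_zero (hr.2.2 _ (left_ne_zero_of_mul hx)) (h.2.2 _ (right_ne_zero_of_mul hx))⟩

lemma IsDichotomy.kpow (h : IsDichotomy p q) (n : ℕ) : IsDichotomy (kpow p n) (kpow q n) :=
  ⟨⟨kpow_nonneg h.1.1 n, by rw [sum_kpow, h.1.2, one_pow]⟩,
    ⟨kpow_nonneg h.2.1.1 n, by rw [sum_kpow, h.2.1.2, one_pow]⟩, fun f hf =>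
      Finset.prod_ne_zero_iff.mpr fun j hj => h.2.2 _ (Finset.prod_ne_zero_iff.mp hf j hj)⟩

lemma isProb_catVec {p : I → ℝ} {q : J → ℝ} (hp : IsProb p) (hq : IsProb q) (n : ℕ) :
    IsProb (catVec n p q) := by
  refine ⟨fun x => mul_nonneg (by positivity) (mul_nonneg
    (Finset.prod_nonneg fun _ _ => hq.1 _) (Finset.prod_nonneg fun _ _ => hp.1 _)), ?_⟩
  have hq' : ∀ m : ℕ, ∑ g : Fin m → J, ∏ j, q (g j) = 1 := fun m => by
    have := sum_kpow q m
    rwa [hq.2, one_pow] at this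
  have hp' : ∀ m : ℕ, ∑ g : Fin m → I, ∏ j, p (g j) = 1 := fun m => by
    have := sum_kpow p m
    rwa [hp.2, one_pow] at this
  have : ∀ k : Fin (n + 1), ∑ g : (Fin (k : ℕ) → J) × (Fin (n - (k : ℕ)) → I),
      catVec n p q ⟨k, g⟩ = 1 / (n + 1 : ℝ) := fun k => by
    have e : (∑ g : Fin (k : ℕ) → J, ∏ j, q (g j)) * (∑ f : Fin (n - k) → I, ∏ j, p (f j)) = 1 := by
      rw [hq', hp', mul_one]
    rw [Finset.sum_mul_sum] at e
    rw [Fintype.sum_prod_type]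
    simp only [catVec, ← Finset.mul_sum]
    rw [e, mul_one]
  rw [Fintype.sum_sigma, Finset.sum_congr rfl fun k _ => this k]
  simp
  field_simp

lemma IsDichotomy.catVec {r₁ r₂ : J → ℝ} (h : IsDichotomy p q) (hr : IsDichotomy r₁ r₂) (n : ℕ) :
    IsDichotomy (catVec n p r₁) (catVec n q r₂) := by
  refine ⟨isProb_catVec h.1 hr.1 n, isProb_catVec h.2.1 hr.2.1 n, fun x hx => ?_⟩
  have h' := right_ne_zero_of_mul hx
  refine mul_ne_zero (by positivity) (mul_ne_zero ?_ ?_)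
  · exact Finset.prod_ne_zero_iff.mpr fun j hj =>
      hr.2.2 _ (Finset.prod_ne_zero_iff.mp (left_ne_zero_of_mul h') j hj)
  · exact Finset.prod_ne_zero_iff.mpr fun j hj =>
      h.2.2 _ (Finset.prod_ne_zero_iff.mp (right_ne_zero_of_mul h') j hj)

/-- The interpolating catalyst turns a hockey-stick inequality between the `(n+1)`-fold powers
into one between the catalysed single copies. -/
lemma sum_max_kron_catVec_le {p₁ p₂ : I → ℝ} {q₁ q₂ : J → ℝ} {n : ℕ} {t : ℝ}
    (h : ∑ g, max (kpow q₁ (n + 1) g - t * kpow q₂ (n + 1) g) 0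
      ≤ ∑ f, max (kpow p₁ (n + 1) f - t * kpow p₂ (n + 1) f) 0) :
    ∑ y, max (kron (catVec n p₁ q₁) q₁ y - t * kron (catVec n p₂ q₂) q₂ y) 0
      ≤ ∑ x, max (kron (catVec n p₁ q₁) p₁ x - t * kron (catVec n p₂ q₂) p₂ x) 0 := by
  let G : ℕ → ℕ → ℝ := fun k m => ∑ g : Fin k → J, ∑ f : Fin m → I,
    max (kpow q₁ k g * kpow p₁ m f - t * (kpow q₂ k g * kpow p₂ m f)) 0
  have hcons : ∀ {K : Type} (w : K → ℝ) (m : ℕ) (x : K) (f : Fin m → K),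
      kpow w (m + 1) (Fin.cons x f) = w x * kpow w m f := by
    intro K w m x f; simp [kpow, Fin.prod_univ_succ]
  have hc : (0 : ℝ) ≤ 1 / (n + 1 : ℝ) := by positivity
  have e1 : ∑ y, max (kron (catVec n p₁ q₁) q₁ y - t * kron (catVec n p₂ q₂) q₂ y) 0
      = 1 / (n + 1 : ℝ) * ∑ k ∈ Finset.range (n + 1), G (k + 1) (n - k) := by
    rw [Fintype.sum_prod_type, Fintype.sum_sigma, Finset.sum_range, Finset.mul_sum]
    refine Finset.sum_congr rfl fun k _ => ?_
    simp only [G]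
    rw [Fintype.sum_prod_type, sum_fin_succ_fun]
    refine Eq.trans ?_ (congrArg (1 / (n + 1 : ℝ) * ·) Finset.sum_comm)
    rw [Finset.mul_sum]
    refine Finset.sum_congr rfl fun g _ => ?_
    rw [Finset.sum_comm, Finset.mul_sum]
    refine Finset.sum_congr rfl fun y _ => ?_
    rw [Finset.mul_sum]
    refine Finset.sum_congr rfl fun f _ => ?_
    rw [hcons, hcons, mul_max_of_nonneg _ _ hc, mul_zero]
    simp only [kron, catVec, kpow]
    congr 1
    ring
  have e2 : ∑ x, max (kron (catVec n p₁ q₁) p₁ x - t * kron (catVec n p₂ q₂) p₂ x) 0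
      = 1 / (n + 1 : ℝ) * ∑ k ∈ Finset.range (n + 1), G k (n - k + 1) := by
    rw [Fintype.sum_prod_type, Fintype.sum_sigma, Finset.sum_range, Finset.mul_sum]
    refine Finset.sum_congr rfl fun k _ => ?_
    rw [Fintype.sum_prod_type, Finset.mul_sum]
    refine Finset.sum_congr rfl fun g _ => ?_
    rw [sum_fin_succ_fun, Finset.sum_comm, Finset.mul_sum]
    refine Finset.sum_congr rfl fun f _ => ?_
    rw [Finset.mul_sum]
    refine Finset.sum_congr rfl fun x _ => ?_
    rw [hcons, hcons, mul_max_of_nonneg _ _ hc, mul_zero]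
    simp only [kron, catVec, kpow]
    congr 1
    ring
  have hG0 : G 0 (n + 1) = ∑ f, max (kpow p₁ (n + 1) f - t * kpow p₂ (n + 1) f) 0 := by
    simp [G, kpow]
  have hG1 : G (n + 1) 0 = ∑ g, max (kpow q₁ (n + 1) g - t * kpow q₂ (n + 1) g) 0 := by
    simp [G, kpow]
  rw [e1, e2]
  refine mul_le_mul_of_nonneg_left ?_ hc
  have := Finset.sum_range_sub (fun k => G k (n + 1 - k)) (n + 1)
  rw [Finset.sum_sub_distrib, Nat.sub_self, Nat.sub_zero, hG0, hG1] at this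
  have e3 : ∑ k ∈ Finset.range (n + 1), G k (n - k + 1)
      = ∑ k ∈ Finset.range (n + 1), G k (n + 1 - k) :=
    Finset.sum_congr rfl fun k hk => by
      rw [Nat.sub_add_comm (Nat.lt_succ_iff.mp (Finset.mem_range.mp hk))]
  have e4 : ∑ k ∈ Finset.range (n + 1), G (k + 1) (n - k)
      = ∑ k ∈ Finset.range (n + 1), G (k + 1) (n + 1 - (k + 1)) :=
    Finset.sum_congr rfl fun k _ => by rw [Nat.add_sub_add_right]
  rw [e3, e4]
  linarith

end Dichotomy

section Renyi

variable {I J : Type} [Fintype I] [Fintype J] {p q : I → ℝ}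

lemma IsProb.exists_ne_zero (h : IsProb p) : ∃ x, p x ≠ 0 := by
  by_contra! h0
  have := h.2
  simp [h0] at this

lemma IsDichotomy.snd_mul_div_rpow (h : IsDichotomy p q) (α : ℝ) {x : I} (hx : p x ≠ 0) :
    q x * (p x / q x) ^ α = p x ^ α * q x ^ (1 - α) := by
  have hq := h.snd_pos hx
  rw [Real.div_rpow (h.1.1 x) hq.le, Real.rpow_sub hq, Real.rpow_one]
  field_simp

lemma fDiv_rpow_eq_sum (h : IsDichotomy p q) {α : ℝ} (hα : 0 < α) :
    fDiv (fun s => s ^ α) p q = ∑ x, p x ^ α * q x ^ (1 - α) := by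
  refine Finset.sum_congr rfl fun x _ => ?_
  by_cases hx : p x = 0
  · simp only [hx, zero_div, Real.zero_rpow hα.ne', mul_zero, zero_mul]
  · exact h.snd_mul_div_rpow α hx

lemma fDiv_rpow_eq_sum_filter (h : IsDichotomy p q) {α : ℝ} (hα : 0 < α) {P : I → Prop}
    [DecidablePred P] (hP : ∀ x, p x ≠ 0 → P x) :
    fDiv (fun s => s ^ α) p q = ∑ x ∈ Finset.univ.filter P, p x ^ α * q x ^ (1 - α) := by
  rw [fDiv_rpow_eq_sum h hα, Finset.sum_filter]
  refine Finset.sum_congr rfl fun x _ => ?_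
  split_ifs with hx
  · rfl
  · rw [not_not.mp (mt (hP x) hx), Real.zero_rpow hα.ne', zero_mul]

lemma renyi_eq_log_fDiv (h : IsDichotomy p q) {α : ℝ} (hα : 0 < α) (hα' : α ≠ 1) :
    renyi α p q = (((α - 1)⁻¹ * Real.log (fDiv (fun s => s ^ α) p q) : ℝ) : EReal) := by
  obtain ⟨x, hx⟩ := h.1.exists_ne_zero
  have hex : ∃ x, p x ≠ 0 ∧ q x ≠ 0 := ⟨x, hx, h.2.2 x hx⟩
  rw [renyi, if_neg (not_not.mpr hex), if_neg hα.ne', if_neg hα', if_pos h.2.2,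
    ← fDiv_rpow_eq_sum_filter h hα fun x hx => ⟨hx, h.2.2 x hx⟩,
    ← fDiv_rpow_eq_sum_filter h hα fun x hx => hx, ite_self]

lemma renyi_one (h : IsDichotomy p q) :
    renyi 1 p q = ((fDiv (fun s => s * Real.log s) p q : ℝ) : EReal) := by
  obtain ⟨x, hx⟩ := h.1.exists_ne_zero
  have hex : ∃ x, p x ≠ 0 ∧ q x ≠ 0 := ⟨x, hx, h.2.2 x hx⟩
  rw [renyi, if_neg (not_not.mpr hex), if_neg one_ne_zero, if_neg (lt_irrefl _), if_pos rfl,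
    if_pos h.2.2, Finset.sum_filter]
  refine congrArg _ (Finset.sum_congr rfl fun x _ => ?_)
  rw [← mul_assoc, h.mul_div]
  split_ifs with hx
  · rfl
  · rw [not_not.mp hx, zero_mul]

variable {p₁ p₂ : I → ℝ} {q₁ q₂ : J → ℝ}

lemma renyi_le_renyi_iff_of_lt_one (hp : IsDichotomy p₁ p₂) (hq : IsDichotomy q₁ q₂) {α : ℝ}
    (hα : 0 < α) (hα' : α < 1) : renyi α q₁ q₂ ≤ renyi α p₁ p₂ ↔
      fDiv (fun s => s ^ α) p₁ p₂ ≤ fDiv (fun s => s ^ α) q₁ q₂ := by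
  rw [renyi_eq_log_fDiv hp hα hα'.ne, renyi_eq_log_fDiv hq hα hα'.ne, EReal.coe_le_coe_iff,
    mul_le_mul_left_of_neg (inv_lt_zero.mpr (sub_neg.mpr hα')),
    Real.log_le_log_iff (fDiv_rpow_pos hp hα) (fDiv_rpow_pos hq hα)]

lemma renyi_le_renyi_iff_of_one_lt (hp : IsDichotomy p₁ p₂) (hq : IsDichotomy q₁ q₂) {α : ℝ}
    (hα : 1 < α) : renyi α q₁ q₂ ≤ renyi α p₁ p₂ ↔
      fDiv (fun s => s ^ α) q₁ q₂ ≤ fDiv (fun s => s ^ α) p₁ p₂ := by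
  have hα₀ : 0 < α := zero_lt_one.trans hα
  rw [renyi_eq_log_fDiv hp hα₀ hα.ne', renyi_eq_log_fDiv hq hα₀ hα.ne', EReal.coe_le_coe_iff,
    mul_le_mul_iff_right₀ (inv_pos.mpr (sub_pos.mpr hα)),
    Real.log_le_log_iff (fDiv_rpow_pos hq hα₀) (fDiv_rpow_pos hp hα₀)]

lemma renyi_one_le_renyi_one_iff (hp : IsDichotomy p₁ p₂) (hq : IsDichotomy q₁ q₂) :
    renyi 1 q₁ q₂ ≤ renyi 1 p₁ p₂ ↔
      fDiv (fun s => s * Real.log s) q₁ q₂ ≤ fDiv (fun s => s * Real.log s) p₁ p₂ := by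
  rw [renyi_one hp, renyi_one hq, EReal.coe_le_coe_iff]

lemma renyiTop_le_renyiTop_iff (hp : IsDichotomy p₁ p₂) (hq : IsDichotomy q₁ q₂) :
    renyiTop q₁ q₂ ≤ renyiTop p₁ p₂ ↔
      ∀ y, q₁ y ≠ 0 → ∃ x, p₁ x ≠ 0 ∧ q₁ y / q₂ y ≤ p₁ x / p₂ x := by
  obtain ⟨x, hx⟩ := hp.1.exists_ne_zero
  obtain ⟨y, hy⟩ := hq.1.exists_ne_zero
  rw [renyiTop, renyiTop, dif_pos ⟨y, hy, hq.2.2 y hy⟩, dif_pos ⟨x, hx, hp.2.2 x hx⟩,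
    if_pos hq.2.2, if_pos hp.2.2, EReal.coe_le_coe_iff, Real.log_le_log_iff]
  · refine (Finset.sup'_le_iff _ _).trans ?_
    simp only [Finset.mem_filter, Finset.mem_univ, true_and]
    refine forall₂_congr fun y _ => (Finset.le_sup'_iff _).trans ?_
    simp only [Finset.mem_filter, Finset.mem_univ, true_and]
  · exact (hq.div_pos hy).trans_le
      (Finset.le_sup' (fun y => q₁ y / q₂ y) (Finset.mem_filter.mpr ⟨Finset.mem_univ y, hy⟩))
  · exact (hp.div_pos hx).trans_le
      (Finset.le_sup' (fun x => p₁ x / p₂ x) (Finset.mem_filter.mpr ⟨Finset.mem_univ x, hx⟩))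

end Renyi

/-- The convex mixture `(1 - ε) p + ε q`. -/
def mixVec {I : Type} (ε : ℝ) (p q : I → ℝ) : I → ℝ := fun x => (1 - ε) * p x + ε * q x

lemma mixVec_div {I : Type} {p q : I → ℝ} (ε : ℝ) {x : I} (hx : q x ≠ 0) :
    mixVec ε p q x / q x = (1 - ε) * (p x / q x) + ε := by
  rw [mixVec, add_div, mul_div_assoc, mul_div_cancel_right₀ _ hx]

section Forward

variable {I J : Type} [Fintype I] [Fintype J]

lemma IsDichotomy.mixVec {p q : I → ℝ} (h : IsDichotomy p q) {ε : ℝ} (h0 : 0 ≤ ε) (h1 : ε ≤ 1) :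
    IsDichotomy (mixVec ε p q) q := by
  refine ⟨⟨fun x => add_nonneg (mul_nonneg (sub_nonneg.mpr h1) (h.1.1 x))
    (mul_nonneg h0 (h.2.1.1 x)), ?_⟩, h.2.1, fun x hx hqx => hx ?_⟩
  · simp only [_root_.mixVec, Finset.sum_add_distrib, ← Finset.mul_sum, h.1.2, h.2.1.2]
    ring
  · have : p x = 0 := by_contra fun h' => h.2.2 x h' hqx
    simp [_root_.mixVec, this, hqx]

lemma dist1_mixVec_le {p q : I → ℝ} (hp : IsProb p) (hq : IsProb q) {ε : ℝ} (h0 : 0 ≤ ε) :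
    dist1 p (mixVec ε p q) ≤ 2 * ε := by
  have : ∀ x, |p x - mixVec ε p q x| ≤ ε * (p x + q x) := fun x => by
    have e : p x - mixVec ε p q x = ε * (p x - q x) := by rw [mixVec]; ring
    rw [e, abs_mul, abs_of_nonneg h0]
    refine mul_le_mul_of_nonneg_left (abs_le.mpr ⟨?_, ?_⟩) h0 <;> linarith [hp.1 x, hq.1 x]
  refine (Finset.sum_le_sum fun x _ => this x).trans_eq ?_
  rw [← Finset.mul_sum, Finset.sum_add_distrib, hp.2, hq.2]
  ring

lemma fDiv_mixVec_le {p q : I → ℝ} (h : IsDichotomy p q) {ε : ℝ} (h0 : 0 ≤ ε) (h1 : ε ≤ 1)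
    {g : ℝ → ℝ} (hg : ConvexOn ℝ (Set.Ici 0) g) :
    fDiv g (mixVec ε p q) q ≤ (1 - ε) * fDiv g p q + ε * g 1 := by
  have e : (1 - ε) * fDiv g p q + ε * g 1 = ∑ x, q x * ((1 - ε) * g (p x / q x) + ε * g 1) := by
    have : ∀ x, q x * ((1 - ε) * g (p x / q x) + ε * g 1)
        = (1 - ε) * (q x * g (p x / q x)) + ε * g 1 * q x := fun x => by ring
    simp only [this, Finset.sum_add_distrib, ← Finset.mul_sum, h.2.1.2, fDiv, mul_one]
  rw [e]
  refine Finset.sum_le_sum fun x _ => ?_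
  by_cases hx : q x = 0
  · rw [hx, zero_mul, zero_mul]
  refine mul_le_mul_of_nonneg_left ?_ (h.2.1.1 x)
  rw [mixVec_div ε hx]
  have := hg.2 (h.div_nonneg x) (zero_le_one (α := ℝ)) (sub_nonneg.mpr h1) h0 (sub_add_cancel 1 ε)
  simpa only [smul_eq_mul, mul_one] using this

/-- Strict support-line inequality for a dichotomy with `p` vanishing somewhere on the support
of `q`. -/
lemma lt_fDiv_of_affine_le {p q : I → ℝ} (h : IsDichotomy p q) {x₁ : I} (hq₁ : q x₁ ≠ 0)
    (hp₁ : p x₁ = 0) {g : ℝ → ℝ} {a b : ℝ} (hg : ∀ s, 0 ≤ s → a + b * s ≤ g s) (hg0 : a < g 0) :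
    a + b < fDiv g p q := by
  rw [← fDiv_affine h a b]
  refine Finset.sum_lt_sum (fun x _ =>
    mul_le_mul_of_nonneg_left (hg _ (h.div_nonneg x)) (h.2.1.1 x)) ⟨x₁, Finset.mem_univ _, ?_⟩
  dsimp only
  rw [hp₁, zero_div, mul_zero, add_zero]
  exact mul_lt_mul_of_pos_left hg0 ((h.2.1.1 x₁).lt_of_ne' hq₁)

lemma fDiv_neg (g : ℝ → ℝ) (p q : I → ℝ) : fDiv (fun s => -g s) p q = -fDiv g p q := by
  simp only [fDiv, mul_neg, Finset.sum_neg_distrib]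

section Strict

variable {p q : I → ℝ} {x₁ : I}

lemma fDiv_rpow_lt_one (h : IsDichotomy p q) (hq₁ : q x₁ ≠ 0) (hp₁ : p x₁ = 0) {α : ℝ}
    (hα : 0 < α) (hα' : α < 1) : fDiv (fun s => s ^ α) p q < 1 := by
  have := lt_fDiv_of_affine_le h hq₁ hp₁ (g := fun s => -s ^ α) (a := α - 1) (b := -α)
    (fun s hs => by
      have := rpow_one_add_le_one_add_mul_self (s := s - 1) (by linarith) hα.le hα'.le
      rw [add_sub_cancel] at this
      linarith) (by rw [Real.zero_rpow hα.ne']; linarith)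
  rw [fDiv_neg] at this
  linarith

lemma one_lt_fDiv_rpow (h : IsDichotomy p q) (hq₁ : q x₁ ≠ 0) (hp₁ : p x₁ = 0) {α : ℝ}
    (hα : 1 < α) : 1 < fDiv (fun s => s ^ α) p q := by
  have := lt_fDiv_of_affine_le h hq₁ hp₁ (g := fun s => s ^ α) (a := 1 - α) (b := α)
    (fun s hs => by
      have := one_add_mul_self_le_rpow_one_add (s := s - 1) (by linarith) hα.le
      rw [add_sub_cancel] at this
      linarith) (by rw [Real.zero_rpow (by linarith)]; linarith)
  linarith

lemma fDiv_mul_log_pos (h : IsDichotomy p q) (hq₁ : q x₁ ≠ 0) (hp₁ : p x₁ = 0) :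
    0 < fDiv (fun s => s * Real.log s) p q := by
  have := lt_fDiv_of_affine_le h hq₁ hp₁ (g := fun s => s * Real.log s) (a := -1) (b := 1)
    (fun s hs => by
      rcases hs.eq_or_lt with rfl | hs
      · simp
      · have := mul_le_mul_of_nonneg_left (Real.one_sub_inv_le_log_of_pos hs) hs.le
        rw [mul_sub, mul_inv_cancel₀ hs.ne'] at this
        linarith) (by simp)
  linarith

lemma exists_one_lt_div_max (h : IsDichotomy p q) (hq₁ : q x₁ ≠ 0) (hp₁ : p x₁ = 0) :
    ∃ x₀, p x₀ ≠ 0 ∧ 1 < p x₀ / q x₀ ∧ ∀ x, p x / q x ≤ p x₀ / q x₀ := by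
  obtain ⟨x₀, -, hx₀⟩ := Finset.exists_max_image Finset.univ (fun x => p x / q x)
    ⟨x₁, Finset.mem_univ _⟩
  have h1 : 1 < p x₀ / q x₀ := by
    by_contra! hle
    have hlt : ∑ x, p x < ∑ x, q x := by
      refine Finset.sum_lt_sum (fun x _ => ?_) ⟨x₁, Finset.mem_univ _, ?_⟩
      · rw [← h.mul_div x]
        exact mul_le_of_le_one_right (h.2.1.1 x) ((hx₀ x (Finset.mem_univ x)).trans hle)
      · rw [hp₁]
        exact (h.2.1.1 x₁).lt_of_ne' hq₁
    rw [h.1.2, h.2.1.2] at hlt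
    exact lt_irrefl _ hlt
  refine ⟨x₀, fun h0 => ?_, h1, fun x => hx₀ x (Finset.mem_univ x)⟩
  rw [h0, zero_div] at h1
  linarith

lemma tiltSum_suppWeight_zero_lt_one (h : IsDichotomy p q) (hq₁ : q x₁ ≠ 0) (hp₁ : p x₁ = 0) :
    tiltSum (suppWeight p q) (logRatio p q) 0 < 1 := by
  simp only [tiltSum, zero_mul, Real.exp_zero, mul_one]
  rw [← h.2.1.2]
  refine Finset.sum_lt_sum (fun x _ => ?_) ⟨x₁, Finset.mem_univ _, ?_⟩
  · unfold suppWeight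
    split_ifs
    · exact le_rfl
    · exact h.2.1.1 x
  · rw [suppWeight, if_neg (not_not.mpr hp₁)]
    exact (h.2.1.1 x₁).lt_of_ne' hq₁

lemma tiltSum_suppWeight_mixVec_zero (h : IsDichotomy p q) {ε : ℝ} (h0 : 0 < ε) (h1 : ε ≤ 1) :
    tiltSum (suppWeight (mixVec ε p q) q) (logRatio (mixVec ε p q) q) 0 = 1 := by
  simp only [tiltSum, zero_mul, Real.exp_zero, mul_one]
  rw [← h.2.1.2]
  refine Finset.sum_congr rfl fun x _ => ?_
  unfold suppWeight
  split_ifs with hx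
  · rfl
  · have h2 := mul_nonneg (sub_nonneg.mpr h1) (h.1.1 x)
    have h3 := mul_nonneg h0.le (h.2.1.1 x)
    have h4 : (1 - ε) * p x + ε * q x = 0 := not_not.mp hx
    have h5 : ε * q x = 0 := by linarith
    exact ((mul_eq_zero.mp h5).resolve_left h0.ne').symm

end Strict

variable {p₁ p₂ : I → ℝ} {q₁ q₂ : J → ℝ}

/-- Ordered divergences force the hockey-stick inequalities for large powers, once the target is
mixed with its reference vector. -/
theorem eventually_hockeyStick_kpow_le (hp : IsDichotomy p₁ p₂) (hq : IsDichotomy q₁ q₂)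
    {x₁ : I} (hx₂ : p₂ x₁ ≠ 0) (hx₁ : p₁ x₁ = 0)
    (hle : ∀ α : ℝ, 0 < α → renyi α q₁ q₂ ≤ renyi α p₁ p₂)
    (htop : renyiTop q₁ q₂ ≤ renyiTop p₁ p₂) {ε : ℝ} (h0 : 0 < ε) (h1 : ε < 1) :
    ∃ N : ℕ, ∀ n ≥ N, ∀ t : ℝ, 0 ≤ t →
      ∑ g, max (kpow (mixVec ε q₁ q₂) n g - t * kpow q₂ n g) 0
        ≤ ∑ f, max (kpow p₁ n f - t * kpow p₂ n f) 0 := by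
  have hm := hq.mixVec h0.le h1.le
  have h1' : 0 < 1 - ε := sub_pos.mpr h1
  obtain ⟨x₀, hx₀, hR, hmax⟩ := exists_one_lt_div_max hp hx₂ hx₁
  have hlow : ∀ α : ℝ, 0 ≤ α → α < 1 → tiltSum (suppWeight p₁ p₂) (logRatio p₁ p₂) α
      < tiltSum (suppWeight (mixVec ε q₁ q₂) q₂) (logRatio (mixVec ε q₁ q₂) q₂) α := by
    intro α hα hα'
    rcases hα.eq_or_lt with rfl | hα
    · rw [tiltSum_suppWeight_mixVec_zero hq h0 h1.le]
      exact tiltSum_suppWeight_zero_lt_one hp hx₂ hx₁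
    · rw [tiltSum_suppWeight hp hα, tiltSum_suppWeight hm hα]
      have h2 := fDiv_mixVec_le hq h0.le h1.le (Real.concaveOn_rpow hα.le hα'.le).neg
      have h3 := (renyi_le_renyi_iff_of_lt_one hp hq hα hα').mp (hle α hα)
      have h4 := fDiv_rpow_lt_one hp hx₂ hx₁ hα hα'
      change fDiv (fun s => -s ^ α) _ _ ≤ _ * fDiv (fun s => -s ^ α) _ _ + _ * (-1 ^ α) at h2
      rw [fDiv_neg, fDiv_neg, Real.one_rpow] at h2
      nlinarith
  have hhigh : ∀ α : ℝ, 1 < α →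
      tiltSum (suppWeight (mixVec ε q₁ q₂) q₂) (logRatio (mixVec ε q₁ q₂) q₂) α
        < tiltSum (suppWeight p₁ p₂) (logRatio p₁ p₂) α := by
    intro α hα
    have hα₀ : 0 < α := zero_lt_one.trans hα
    rw [tiltSum_suppWeight hp hα₀, tiltSum_suppWeight hm hα₀]
    have h2 := fDiv_mixVec_le hq h0.le h1.le (convexOn_rpow hα.le)
    have h3 := (renyi_le_renyi_iff_of_one_lt hp hq hα).mp (hle α hα₀)
    have h4 := one_lt_fDiv_rpow hp hx₂ hx₁ hα
    rw [Real.one_rpow] at h2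
    nlinarith
  have hmean : tiltMean (suppWeight (mixVec ε q₁ q₂) q₂) (logRatio (mixVec ε q₁ q₂) q₂) 1
      < tiltMean (suppWeight p₁ p₂) (logRatio p₁ p₂) 1 := by
    rw [tiltMean_suppWeight_one hp, tiltMean_suppWeight_one hm]
    have h2 := fDiv_mixVec_le hq h0.le h1.le Real.convexOn_mul_log
    have h3 := (renyi_one_le_renyi_one_iff hp hq).mp (hle 1 one_pos)
    have h4 := fDiv_mul_log_pos hp hx₂ hx₁
    rw [Real.log_one, mul_zero, mul_zero, add_zero] at h2
    nlinarith
  have hR' : (1 - ε) * (p₁ x₀ / p₂ x₀) + ε < p₁ x₀ / p₂ x₀ := by nlinarith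
  have hR₀ : 0 < (1 - ε) * (p₁ x₀ / p₂ x₀) + ε := by positivity
  obtain ⟨N, hN⟩ := eventually_pathExcess_le (suppWeight_nonneg hp) (suppWeight_nonneg hm)
    (tiltSum_suppWeight_one hp) (tiltSum_suppWeight_one hm) hlow hhigh hmean (x₀ := x₀)
    (by rw [suppWeight, if_pos hx₀]; exact hp.snd_pos hx₀) (Real.log_lt_log hR₀ hR')
    (fun y hy => by
      have hy' : mixVec ε q₁ q₂ y ≠ 0 := fun h => hy (if_neg (not_not.mpr h))
      refine Real.log_le_log (hm.div_pos hy') ?_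
      rw [mixVec_div ε (hm.2.2 y hy')]
      refine add_le_add (mul_le_mul_of_nonneg_left ?_ h1'.le) le_rfl
      by_cases hy₁ : q₁ y = 0
      · rw [hy₁, zero_div]
        exact hp.div_nonneg x₀
      · obtain ⟨x, -, hx⟩ := (renyiTop_le_renyiTop_iff hp hq).mp htop y hy₁
        exact hx.trans (hmax x))
  refine ⟨N, fun n hn t ht => ?_⟩
  rw [sum_max_kpow hp n ht, sum_max_kpow hm n ht]
  exact hN n hn t ht

lemma approximants_of_renyi_le (hp : IsDichotomy p₁ p₂) (hq : IsDichotomy q₁ q₂)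
    (hproper : ∃ x, p₂ x ≠ 0 ∧ p₁ x = 0)
    (hle : ∀ α : ℝ, 0 < α → renyi α q₁ q₂ ≤ renyi α p₁ p₂)
    (htop : renyiTop q₁ q₂ ≤ renyiTop p₁ p₂) {ε : ℝ} (h0 : 0 < ε) :
    ∃ qe : J → ℝ, IsDichotomy qe q₂ ∧ dist1 q₁ qe ≤ ε ∧ ∃ N : ℕ, ∀ n ≥ N, ∀ t : ℝ, 0 ≤ t →
      ∑ g, max (kpow qe n g - t * kpow q₂ n g) 0 ≤ ∑ f, max (kpow p₁ n f - t * kpow p₂ n f) 0 := by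
  obtain ⟨x₁, hx₂, hx₁⟩ := hproper
  have h1 : 0 < min (ε / 2) (1 / 2) := by positivity
  have h2 : min (ε / 2) (1 / 2) < 1 := (min_le_right _ _).trans_lt (by norm_num)
  refine ⟨_, hq.mixVec h1.le h2.le, (dist1_mixVec_le hq.1 hq.2.1 h1.le).trans ?_,
    eventually_hockeyStick_kpow_le hp hq hx₂ hx₁ hle htop h1 h2⟩
  linarith [min_le_left (ε / 2) (1 / 2)]

lemma dist1_self (p : I → ℝ) : dist1 p p = 0 := by simp [dist1]

lemma condLS_of_renyi_le (hp : IsDichotomy p₁ p₂) (hq : IsDichotomy q₁ q₂)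
    (hproper : ∃ x, p₂ x ≠ 0 ∧ p₁ x = 0)
    (hle : ∀ α : ℝ, 0 < α → renyi α q₁ q₂ ≤ renyi α p₁ p₂)
    (htop : renyiTop q₁ q₂ ≤ renyiTop p₁ p₂) : CondLS p₁ p₂ q₁ q₂ (fun r => r = q₂) := by
  intro ε h0
  obtain ⟨qe, hqe, hd, N, hN⟩ := approximants_of_renyi_le hp hq hproper hle htop h0
  exact ⟨qe, q₂, hqe, hd, (dist1_self q₂).trans_le h0.le, rfl, N, fun n hn =>
    exists_isStoch_of_hockeyStick_le (hp.kpow n) (hqe.kpow n) (hN n hn)⟩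

lemma condCat_of_renyi_le (hp : IsDichotomy p₁ p₂) (hq : IsDichotomy q₁ q₂)
    (hproper : ∃ x, p₂ x ≠ 0 ∧ p₁ x = 0)
    (hle : ∀ α : ℝ, 0 < α → renyi α q₁ q₂ ≤ renyi α p₁ p₂)
    (htop : renyiTop q₁ q₂ ≤ renyiTop p₁ p₂) : CondCat p₁ p₂ q₁ q₂ (fun r => r = q₂) := by
  intro ε h0
  obtain ⟨qe, hqe, hd, N, hN⟩ := approximants_of_renyi_le hp hq hproper hle htop h0
  have key : ∀ n ≥ N, ∃ T : CatIdx I J n × J → CatIdx I J n × I → ℝ, IsStoch T ∧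
      (∀ y, ∑ x, T y x * kron (catVec n p₁ qe) p₁ x = kron (catVec n p₁ qe) qe y) ∧
      (∀ y, ∑ x, T y x * kron (catVec n p₂ q₂) p₂ x = kron (catVec n p₂ q₂) q₂ y) := fun n hn =>
    exists_isStoch_of_hockeyStick_le ((hp.catVec hqe n).kron hp) ((hp.catVec hqe n).kron hqe)
      fun t ht => sum_max_kron_catVec_le (hN (n + 1) (hn.trans n.le_succ) t ht)
  exact ⟨qe, q₂, hqe, hd, (dist1_self q₂).trans_le h0.le, rfl,
    ⟨CatIdx I J N, inferInstance, _, _, hp.catVec hqe N, key N le_rfl⟩, N, key⟩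

end Forward

section Reverse

open Filter Topology

variable {I J : Type} [Fintype I] [Fintype J] {p₁ p₂ : I → ℝ} {q₁ q₂ : J → ℝ}

/-- Data processing inequality for `f`-divergences. -/
lemma fDiv_le_of_isStoch (hp : IsDichotomy p₁ p₂) {T : J → I → ℝ} (hT : IsStoch T)
    (h₁ : ∀ y, ∑ x, T y x * p₁ x = q₁ y) (h₂ : ∀ y, ∑ x, T y x * p₂ x = q₂ y)
    {g : ℝ → ℝ} (hg : ConvexOn ℝ (Set.Ici 0) g) : fDiv g q₁ q₂ ≤ fDiv g p₁ p₂ := by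
  have hw : ∀ y x, 0 ≤ T y x * p₂ x := fun y x => mul_nonneg (hT.1 y x) (hp.2.1.1 x)
  have key : ∀ y, q₂ y * g (q₁ y / q₂ y) ≤ ∑ x, T y x * p₂ x * g (p₁ x / p₂ x) := by
    intro y
    by_cases hy : q₂ y = 0
    · have h0 := (Finset.sum_eq_zero_iff_of_nonneg fun x _ => hw y x).mp ((h₂ y).trans hy)
      rw [hy, zero_mul, Finset.sum_eq_zero fun x hx => by rw [h0 x hx, zero_mul]]
    · have hy' : 0 < q₂ y :=
        ((Finset.sum_nonneg fun x _ => hw y x).trans_eq (h₂ y)).lt_of_ne' hy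
      have hJ := hg.map_sum_le (t := Finset.univ) (w := fun x => T y x * p₂ x / q₂ y)
        (p := fun x => p₁ x / p₂ x) (fun x _ => div_nonneg (hw y x) hy'.le)
        (by rw [← Finset.sum_div, h₂, div_self hy]) (fun x _ => hp.div_nonneg x)
      have e : ∑ x, (T y x * p₂ x / q₂ y) • (p₁ x / p₂ x) = q₁ y / q₂ y := by
        rw [← h₁ y, Finset.sum_div]
        refine Finset.sum_congr rfl fun x _ => ?_
        rw [smul_eq_mul, ← hp.mul_div x, hp.mul_div x, div_mul_eq_mul_div, mul_assoc, hp.mul_div x]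
      rw [e] at hJ
      refine (mul_le_mul_of_nonneg_left hJ hy'.le).trans_eq ?_
      rw [Finset.mul_sum]
      refine Finset.sum_congr rfl fun x _ => ?_
      rw [smul_eq_mul]
      field_simp
  refine (Finset.sum_le_sum fun y _ => key y).trans_eq ?_
  rw [Finset.sum_comm]
  refine Finset.sum_congr rfl fun x _ => ?_
  simp only [mul_assoc]
  rw [← Finset.sum_mul, hT.2, one_mul]

lemma fDiv_rpow_kron (hp : IsDichotomy p₁ p₂) (hq : IsDichotomy q₁ q₂) (α : ℝ) :
    fDiv (fun s => s ^ α) (kron p₁ q₁) (kron p₂ q₂)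
      = fDiv (fun s => s ^ α) p₁ p₂ * fDiv (fun s => s ^ α) q₁ q₂ := by
  simp only [fDiv]
  rw [Finset.sum_mul_sum, Fintype.sum_prod_type]
  refine Finset.sum_congr rfl fun x _ => Finset.sum_congr rfl fun y _ => ?_
  rw [kron, kron, mul_div_mul_comm, Real.mul_rpow (hp.div_nonneg x) (hq.div_nonneg y)]
  ring

lemma fDiv_rpow_kpow (hp : IsDichotomy p₁ p₂) (α : ℝ) (n : ℕ) :
    fDiv (fun s => s ^ α) (kpow p₁ n) (kpow p₂ n) = fDiv (fun s => s ^ α) p₁ p₂ ^ n := by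
  simp only [fDiv]
  rw [← sum_kpow]
  refine Finset.sum_congr rfl fun f _ => ?_
  rw [kpow, kpow, kpow, Finset.prod_mul_distrib, ← Finset.prod_div_distrib,
    Real.finsetProd_rpow _ _ fun j _ => hp.div_nonneg (f j)]

/-- Data processing for the power sums underlying the Rényi divergences. -/
lemma fDiv_rpow_of_isStoch (hp : IsDichotomy p₁ p₂) {T : J → I → ℝ} (hT : IsStoch T)
    (h₁ : ∀ y, ∑ x, T y x * p₁ x = q₁ y) (h₂ : ∀ y, ∑ x, T y x * p₂ x = q₂ y) :
    (∀ α : ℝ, 0 < α → α < 1 → fDiv (fun s => s ^ α) p₁ p₂ ≤ fDiv (fun s => s ^ α) q₁ q₂) ∧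
      ∀ α : ℝ, 1 < α → fDiv (fun s => s ^ α) q₁ q₂ ≤ fDiv (fun s => s ^ α) p₁ p₂ := by
  refine ⟨fun α h0 h1 => ?_, fun α h1 => fDiv_le_of_isStoch hp hT h₁ h₂ (convexOn_rpow h1.le)⟩
  have := fDiv_le_of_isStoch hp hT h₁ h₂ (Real.concaveOn_rpow h0.le h1.le).neg
  change fDiv (fun s => -s ^ α) _ _ ≤ fDiv (fun s => -s ^ α) _ _ at this
  rw [fDiv_neg, fDiv_neg] at this
  exact neg_le_neg_iff.mp this

/-- The power sums of `(q₁, q₂)` are approximated by ones that are ordered relative to those of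
`(p₁, p₂)`. -/
def ApproxOrdered (p₁ p₂ : I → ℝ) (q₁ q₂ : J → ℝ) : Prop :=
  ∀ ε : ℝ, 0 < ε → ∃ qe₁ qe₂ : J → ℝ, IsDichotomy qe₁ qe₂ ∧
    dist1 q₁ qe₁ ≤ ε ∧ dist1 q₂ qe₂ ≤ ε ∧
    (∀ α : ℝ, 0 < α → α < 1 → fDiv (fun s => s ^ α) p₁ p₂ ≤ fDiv (fun s => s ^ α) qe₁ qe₂) ∧
      ∀ α : ℝ, 1 < α → fDiv (fun s => s ^ α) qe₁ qe₂ ≤ fDiv (fun s => s ^ α) p₁ p₂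

lemma CondCat.approxOrdered {extra : (J → ℝ) → Prop} (hp : IsDichotomy p₁ p₂)
    (h : CondCat p₁ p₂ q₁ q₂ extra) : ApproxOrdered p₁ p₂ q₁ q₂ := by
  intro ε h0
  obtain ⟨qe₁, qe₂, hqe, hd₁, hd₂, -, ⟨R, _, r₁, r₂, hr, T, hT, h₁, h₂⟩, -⟩ := h ε h0
  obtain ⟨hlow, hhigh⟩ := fDiv_rpow_of_isStoch (hr.kron hp) hT h₁ h₂
  refine ⟨qe₁, qe₂, hqe, hd₁, hd₂, fun α hα hα' => ?_, fun α hα => ?_⟩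
  · have := hlow α hα hα'
    rw [fDiv_rpow_kron hr hp, fDiv_rpow_kron hr hqe] at this
    exact le_of_mul_le_mul_left this (fDiv_rpow_pos hr hα)
  · have := hhigh α hα
    rw [fDiv_rpow_kron hr hp, fDiv_rpow_kron hr hqe] at this
    exact le_of_mul_le_mul_left this (fDiv_rpow_pos hr (zero_lt_one.trans hα))

lemma CondLS.approxOrdered {extra : (J → ℝ) → Prop} (hp : IsDichotomy p₁ p₂)
    (h : CondLS p₁ p₂ q₁ q₂ extra) : ApproxOrdered p₁ p₂ q₁ q₂ := by
  intro ε h0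
  obtain ⟨qe₁, qe₂, hqe, hd₁, hd₂, -, N, hN⟩ := h ε h0
  obtain ⟨T, hT, h₁, h₂⟩ := hN (N + 1) N.le_succ
  obtain ⟨hlow, hhigh⟩ := fDiv_rpow_of_isStoch (hp.kpow (N + 1)) hT h₁ h₂
  refine ⟨qe₁, qe₂, hqe, hd₁, hd₂, fun α hα hα' => ?_, fun α hα => ?_⟩
  · have := hlow α hα hα'
    rw [fDiv_rpow_kpow hp, fDiv_rpow_kpow hqe] at this
    exact (pow_le_pow_iff_left₀ (fDiv_rpow_pos hp hα).le (fDiv_rpow_pos hqe hα).le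
      N.succ_ne_zero).mp this
  · have hα₀ := zero_lt_one.trans hα
    have := hhigh α hα
    rw [fDiv_rpow_kpow hp, fDiv_rpow_kpow hqe] at this
    exact (pow_le_pow_iff_left₀ (fDiv_rpow_pos hqe hα₀).le (fDiv_rpow_pos hp hα₀).le
      N.succ_ne_zero).mp this

lemma tendsto_of_dist1_le {u : ℕ → I → ℝ} {p : I → ℝ}
    (h : ∀ k, dist1 p (u k) ≤ 1 / ((k : ℝ) + 1)) (x : I) :
    Tendsto (fun k => u k x) atTop (𝓝 (p x)) := by
  rw [tendsto_iff_dist_tendsto_zero]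
  refine squeeze_zero (fun _ => dist_nonneg) (fun k => ?_) tendsto_one_div_add_atTop_nhds_zero_nat
  rw [dist_comm, Real.dist_eq]
  exact (Finset.single_le_sum (f := fun x => |p x - u k x|) (fun _ _ => abs_nonneg _)
    (Finset.mem_univ x)).trans (h k)

lemma ApproxOrdered.fDiv_rpow_le (hq : IsDichotomy q₁ q₂) (h : ApproxOrdered p₁ p₂ q₁ q₂) :
    (∀ α : ℝ, 0 < α → α < 1 → fDiv (fun s => s ^ α) p₁ p₂ ≤ fDiv (fun s => s ^ α) q₁ q₂) ∧
      ∀ α : ℝ, 1 < α → fDiv (fun s => s ^ α) q₁ q₂ ≤ fDiv (fun s => s ^ α) p₁ p₂ := by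
  choose u v huv hu hv hlow hhigh using fun k : ℕ => h (1 / ((k : ℝ) + 1)) Nat.one_div_pos_of_nat
  have hu' := tendsto_of_dist1_le hu
  have hv' := tendsto_of_dist1_le hv
  refine ⟨fun α hα hα' => ?_, fun α hα => ?_⟩
  · rw [fDiv_rpow_eq_sum hq hα]
    refine ge_of_tendsto' (tendsto_finsetSum _ fun y _ =>
      ((hu' y).rpow_const (Or.inr hα.le)).mul
        ((hv' y).rpow_const (Or.inr (sub_nonneg.mpr hα'.le)))) fun k => ?_
    rw [← fDiv_rpow_eq_sum (huv k) hα]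
    exact hlow k α hα hα'
  · have hα₀ := zero_lt_one.trans hα
    rw [fDiv_rpow_eq_sum_filter hq hα₀ fun y hy => hy]
    refine le_of_tendsto' (tendsto_finsetSum _ fun y hy =>
      ((hu' y).rpow_const (Or.inr hα₀.le)).mul
        ((hv' y).rpow_const (Or.inl (hq.2.2 y (Finset.mem_filter.mp hy).2)))) fun k => ?_
    refine le_trans ?_ (hhigh k α hα)
    rw [fDiv_rpow_eq_sum (huv k) hα₀]
    exact Finset.sum_le_sum_of_subset_of_nonneg (Finset.filter_subset _ _) fun y _ _ =>
      mul_nonneg (Real.rpow_nonneg ((huv k).1.1 y) _) (Real.rpow_nonneg ((huv k).2.1.1 y) _)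

lemma fDiv_mul_log_le_of_fDiv_rpow_le (hp : IsDichotomy p₁ p₂) (hq : IsDichotomy q₁ q₂)
    (h : ∀ α : ℝ, 1 < α → fDiv (fun s => s ^ α) q₁ q₂ ≤ fDiv (fun s => s ^ α) p₁ p₂) :
    fDiv (fun s => s * Real.log s) q₁ q₂ ≤ fDiv (fun s => s * Real.log s) p₁ p₂ := by
  have hd := (hasDerivAt_tiltSum (suppWeight p₁ p₂) (logRatio p₁ p₂) 1).sub
    (hasDerivAt_tiltSum (suppWeight q₁ q₂) (logRatio q₁ q₂) 1)
  rw [sum_suppWeight_mul_exp_mul hp, sum_suppWeight_mul_exp_mul hq] at hd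
  have hlim := hd.tendsto_slope.mono_left
    (nhdsWithin_mono 1 fun α (hα : α ∈ Set.Ioi (1 : ℝ)) => (ne_of_gt hα : α ≠ 1))
  refine sub_nonneg.mp (ge_of_tendsto hlim ?_)
  filter_upwards [self_mem_nhdsWithin] with α hα
  have hα : 1 < α := hα
  have hα₀ := zero_lt_one.trans hα
  rw [slope_def_field]
  simp only [Pi.sub_apply]
  rw [tiltSum_suppWeight_one hp, tiltSum_suppWeight_one hq,
    tiltSum_suppWeight hp hα₀, tiltSum_suppWeight hq hα₀]
  exact div_nonneg (by linarith [h α hα]) (by linarith)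

lemma exists_div_le_of_fDiv_rpow_le (hp : IsDichotomy p₁ p₂) (hq : IsDichotomy q₁ q₂)
    (h : ∀ α : ℝ, 1 < α → fDiv (fun s => s ^ α) q₁ q₂ ≤ fDiv (fun s => s ^ α) p₁ p₂)
    {y : J} (hy : q₁ y ≠ 0) : ∃ x, p₁ x ≠ 0 ∧ q₁ y / q₂ y ≤ p₁ x / p₂ x := by
  obtain ⟨x', hx'⟩ := hp.1.exists_ne_zero
  obtain ⟨x₀, -, hmax⟩ := Finset.exists_max_image Finset.univ (fun x => p₁ x / p₂ x)
    ⟨x', Finset.mem_univ _⟩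
  have hR : 0 < p₁ x₀ / p₂ x₀ := (hp.div_pos hx').trans_le (hmax x' (Finset.mem_univ _))
  refine ⟨x₀, fun h0 => by simp [h0] at hR, ?_⟩
  by_contra! hlt
  have hq₂ := hq.snd_pos hy
  obtain ⟨n, hn⟩ := pow_unbounded_of_one_lt (1 / q₂ y) ((one_lt_div hR).mpr hlt)
  have hn' := hn.trans_le (pow_le_pow_right₀ ((one_lt_div hR).mpr hlt).le (n.le_add_right 2))
  have h1 : (1 : ℝ) < ((n + 2 : ℕ) : ℝ) := by exact_mod_cast (by omega : 1 < n + 2)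
  have hle := h _ h1
  simp only [fDiv, Real.rpow_natCast] at hle
  have hlow := (Finset.single_le_sum (f := fun y => q₂ y * (q₁ y / q₂ y) ^ (n + 2))
    (fun y _ => mul_nonneg (hq.2.1.1 y) (pow_nonneg (hq.div_nonneg y) _)) (Finset.mem_univ y))
  have hup : ∑ x, p₂ x * (p₁ x / p₂ x) ^ (n + 2) ≤ (p₁ x₀ / p₂ x₀) ^ (n + 2) := by
    calc _ ≤ ∑ x, p₂ x * (p₁ x₀ / p₂ x₀) ^ (n + 2) := Finset.sum_le_sum fun x hx =>
          mul_le_mul_of_nonneg_left (pow_le_pow_left₀ (hp.div_nonneg x) (hmax x hx) _)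
            (hp.2.1.1 x)
      _ = _ := by rw [← Finset.sum_mul, hp.2.1.2, one_mul]
  rw [div_pow, div_lt_div_iff₀ hq₂ (pow_pos hR _), one_mul, mul_comm] at hn'
  linarith [hlow]

lemma ApproxOrdered.renyi_le (hp : IsDichotomy p₁ p₂) (hq : IsDichotomy q₁ q₂)
    (h : ApproxOrdered p₁ p₂ q₁ q₂) :
    (∀ α : ℝ, 0 < α → renyi α q₁ q₂ ≤ renyi α p₁ p₂) ∧ renyiTop q₁ q₂ ≤ renyiTop p₁ p₂ := by
  obtain ⟨hlow, hhigh⟩ := h.fDiv_rpow_le hq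
  refine ⟨fun α hα => ?_, (renyiTop_le_renyiTop_iff hp hq).mpr fun y hy =>
    exists_div_le_of_fDiv_rpow_le hp hq hhigh hy⟩
  rcases lt_trichotomy α 1 with hα' | rfl | hα'
  · exact (renyi_le_renyi_iff_of_lt_one hp hq hα hα').mpr (hlow α hα hα')
  · exact (renyi_one_le_renyi_one_iff hp hq).mpr (fDiv_mul_log_le_of_fDiv_rpow_le hp hq hhigh)
  · exact (renyi_le_renyi_iff_of_one_lt hp hq hα').mpr (hhigh α hα')

lemma CondCat.mono {extra extra' : (J → ℝ) → Prop} (h : CondCat p₁ p₂ q₁ q₂ extra)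
    (hext : ∀ r, extra r → extra' r) : CondCat p₁ p₂ q₁ q₂ extra' := fun ε h0 => by
  obtain ⟨qe₁, qe₂, hqe, hd₁, hd₂, he, hrest⟩ := h ε h0
  exact ⟨qe₁, qe₂, hqe, hd₁, hd₂, hext _ he, hrest⟩

lemma CondLS.mono {extra extra' : (J → ℝ) → Prop} (h : CondLS p₁ p₂ q₁ q₂ extra)
    (hext : ∀ r, extra r → extra' r) : CondLS p₁ p₂ q₁ q₂ extra' := fun ε h0 => by
  obtain ⟨qe₁, qe₂, hqe, hd₁, hd₂, he, hrest⟩ := h ε h0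
  exact ⟨qe₁, qe₂, hqe, hd₁, hd₂, hext _ he, hrest⟩

end Reverse

/-- asymptotic regime for dichotomies with strict domination.  Let
`(p₁,p₂)`, `(q₁,q₂)` be dichotomies with `supp p₁ ⊊ supp p₂`.  The inequalities
`D_α(p₁‖p₂) ≥ D_α(q₁‖q₂)` for all `α ∈ (0,∞]`, approximate catalytic majorization
and approximate large-sample majorization are equivalent; moreover in the approximate
conditions one may keep `qε₂ = q₂` exactly. -/
theorem stmt17 {I J : Type} [Fintype I] [Fintype J]
    (p₁ p₂ : I → ℝ) (q₁ q₂ : J → ℝ)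
    (hp : IsDichotomy p₁ p₂) (hq : IsDichotomy q₁ q₂)
    (hproper : ∃ x, p₂ x ≠ 0 ∧ p₁ x = 0) :
    (((∀ α : ℝ, 0 < α → renyi α q₁ q₂ ≤ renyi α p₁ p₂) ∧
        renyiTop q₁ q₂ ≤ renyiTop p₁ p₂) ↔
      CondCat p₁ p₂ q₁ q₂ (fun _ => True)) ∧
    (((∀ α : ℝ, 0 < α → renyi α q₁ q₂ ≤ renyi α p₁ p₂) ∧
        renyiTop q₁ q₂ ≤ renyiTop p₁ p₂) ↔
      CondLS p₁ p₂ q₁ q₂ (fun _ => True)) ∧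
    (((∀ α : ℝ, 0 < α → renyi α q₁ q₂ ≤ renyi α p₁ p₂) ∧
        renyiTop q₁ q₂ ≤ renyiTop p₁ p₂) →
      CondCat p₁ p₂ q₁ q₂ (fun r => r = q₂) ∧ CondLS p₁ p₂ q₁ q₂ (fun r => r = q₂)) := by
  refine ⟨⟨fun h => (condCat_of_renyi_le hp hq hproper h.1 h.2).mono fun _ _ => trivial,
      fun h => (h.approxOrdered hp).renyi_le hp hq⟩,
    ⟨fun h => (condLS_of_renyi_le hp hq hproper h.1 h.2).mono fun _ _ => trivial,
      fun h => (h.approxOrdered hp).renyi_le hp hq⟩,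
    fun h => ⟨condCat_of_renyi_le hp hq hproper h.1 h.2,
      condLS_of_renyi_le hp hq hproper h.1 h.2⟩⟩
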